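/- Every reducible completed primitive graph Γ is isomorphic to a gluing of two completed primitive graphs Γ₁ and Γ₂, and for any presentation of a completed primitive graph Γ as a gluing of completed primitive graphs Γ₁ and Γ₂ one has P_Γ = P_{Γ₁} · P_{Γ₂}, where P_Γ denotes the common value P(Γ∖v) over all vertices v of Γ. -/

import Mathlib

open scoped Classical
open Matrix

/-- The graph polynomial (Kirchhoff polynomial) of a finite simple graph `G`:
`Ψ_G = Σ_T Π_{e ∉ T} x_e`, summed over spanning trees `T` of `G`. -/
noncomputable def graphPoly {V : Type*} [Fintype V] (G : SimpleGraph V) :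
    MvPolynomial G.edgeSet ℤ :=
  letI : Fintype G.edgeSet := Fintype.ofFinite _
  ∑ T : Finset G.edgeSet,
    if (SimpleGraph.fromEdgeSet (Subtype.val '' (T : Set G.edgeSet))).IsTree then
      ∏ e ∈ Tᶜ, MvPolynomial.X e
    else 0

/-- A connected 4-regular simple graph with at least 5 vertices is completed primitive if
removing any 4 edges leaves it either connected or with an isolated vertex. -/
def IsCompletedPrimitive {W : Type*} [Fintype W] (Γ : SimpleGraph W) : Prop :=
  Γ.Connected ∧ (∀ w : W, Nat.card (Γ.neighborSet w) = 4) ∧ 5 ≤ Fintype.card W ∧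
  ∀ C : Set (Sym2 W), C ⊆ Γ.edgeSet → Nat.card C = 4 →
    (Γ.deleteEdges C).Connected ∨ ∃ w : W, ∀ u : W, ¬ (Γ.deleteEdges C).Adj w u

/-- `Γ ∖ v`: delete the vertex `v` and all incident edges. -/
def delVert {W : Type*} (Γ : SimpleGraph W) (v : W) : SimpleGraph ↥{u : W | u ≠ v} :=
  SimpleGraph.induce {u : W | u ≠ v} Γ

/-- The period integral of `G` with the variable of the edge `e₀` set to `1`,
integrated over the open positive orthant in the remaining edge variables. -/
noncomputable def graphPeriod {V : Type*} [Fintype V] (G : SimpleGraph V)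
    (e₀ : G.edgeSet) : ℝ :=
  letI : Fintype G.edgeSet := Fintype.ofFinite _
  ∫ x in (Set.univ.pi fun _ : {e : G.edgeSet // e ≠ e₀} => Set.Ioi (0 : ℝ)),
    1 / (MvPolynomial.aeval (fun e : G.edgeSet =>
      if h : e = e₀ then (1 : ℝ) else x ⟨e, h⟩) (graphPoly G)) ^ 2

/-- `(a,b,c)` is a triangle of `Γ`. -/
def IsTriangle {W : Type*} (Γ : SimpleGraph W) (a b c : W) : Prop :=
  Γ.Adj a b ∧ Γ.Adj b c ∧ Γ.Adj c a

/-- The gluing of `Γ₁` and `Γ₂` along the triangles `(a₁,b₁,c₁)`, `(a₂,b₂,c₂)`: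
identify `a₁` with `a₂`, `b₁` with `b₂`, `c₁` with `c₂`, and delete the six
triangle edges. -/
def gluedGraph {W₁ W₂ : Type*} (Γ₁ : SimpleGraph W₁) (Γ₂ : SimpleGraph W₂)
    (a₁ b₁ c₁ : W₁) (a₂ b₂ c₂ : W₂) :
    SimpleGraph (W₁ ⊕ {w : W₂ // w ≠ a₂ ∧ w ≠ b₂ ∧ w ≠ c₂}) :=
  SimpleGraph.fromRel fun p q =>
    match p, q with
    | Sum.inl u, Sum.inl v =>
        Γ₁.Adj u v ∧ ¬((u = a₁ ∨ u = b₁ ∨ u = c₁) ∧ (v = a₁ ∨ v = b₁ ∨ v = c₁))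
    | Sum.inl u, Sum.inr z =>
        (u = a₁ ∧ Γ₂.Adj a₂ ↑z) ∨ (u = b₁ ∧ Γ₂.Adj b₂ ↑z) ∨ (u = c₁ ∧ Γ₂.Adj c₂ ↑z)
    | Sum.inr _, Sum.inl _ => False
    | Sum.inr z, Sum.inr z' => Γ₂.Adj ↑z ↑z'

/-- `Γ` is (isomorphic to) a gluing of `Γ₁` and `Γ₂` on triangle faces. -/
def IsGluing {W W₁ W₂ : Type*} (Γ : SimpleGraph W)
    (Γ₁ : SimpleGraph W₁) (Γ₂ : SimpleGraph W₂) : Prop :=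
  ∃ (a₁ b₁ c₁ : W₁) (a₂ b₂ c₂ : W₂),
    IsTriangle Γ₁ a₁ b₁ c₁ ∧ IsTriangle Γ₂ a₂ b₂ c₂ ∧
    Nonempty (Γ ≃g gluedGraph Γ₁ Γ₂ a₁ b₁ c₁ a₂ b₂ c₂)

/-- A graph is reducible if it becomes disconnected after removing some three vertices. -/
def IsReducible {W : Type*} (Γ : SimpleGraph W) : Prop :=
  ∃ v₁ v₂ v₃ : W, v₁ ≠ v₂ ∧ v₁ ≠ v₃ ∧ v₂ ≠ v₃ ∧
    ¬ (SimpleGraph.induce {u : W | u ≠ v₁ ∧ u ≠ v₂ ∧ u ≠ v₃} Γ).Connected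

section helpers
open MeasureTheory
open scoped ENNReal

noncomputable instance instMSQuat : MeasurableSpace (Quaternion ℝ) := borel _
instance instBSQuat : BorelSpace (Quaternion ℝ) := ⟨rfl⟩

/-- quaternions -/
abbrev HH := Quaternion ℝ

lemma HH_abs_det (L : HH →ₗ[ℝ] HH) (c : ℝ) (hc : 0 < c) (hL : ∀ x, ‖L x‖ = c * ‖x‖) :
    |LinearMap.det L| = c ^ 4 := by
  have hinj : Function.Injective L := by
    rw [injective_iff_map_eq_zero]
    intro x hx
    have := hL x
    rw [hx, norm_zero] at this
    have h2 : ‖x‖ = 0 := by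
      rcases mul_eq_zero.1 this.symm with h | h
      · exact absurd h hc.ne'
      · exact h
    exact norm_eq_zero.1 h2
  have hsurj : Function.Surjective L := LinearMap.injective_iff_surjective.1 hinj
  have him : L '' Metric.closedBall 0 1 = Metric.closedBall 0 (c * 1) := by
    ext y
    simp only [Set.mem_image, Metric.mem_closedBall, dist_zero_right]
    constructor
    · rintro ⟨x, hx, rfl⟩
      rw [hL]
      exact mul_le_mul_of_nonneg_left hx hc.le
    · intro hy
      obtain ⟨x, rfl⟩ := hsurj y
      rw [hL] at hy
      exact ⟨x, le_of_mul_le_mul_left hy hc, rfl⟩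
  have h1 := Measure.addHaar_image_linearMap (volume : Measure HH) L (Metric.closedBall 0 1)
  rw [him, Measure.addHaar_closedBall_mul _ _ hc.le] at h1
  have hpos : (volume : Measure HH) (Metric.closedBall 0 1) ≠ 0 :=
    (Metric.measure_closedBall_pos _ _ one_pos).ne'
  have hfin : (volume : Measure HH) (Metric.closedBall 0 1) ≠ ∞ := measure_closedBall_lt_top.ne
  rw [ENNReal.mul_left_inj hpos hfin] at h1
  have h2 := (ENNReal.ofReal_eq_ofReal_iff (by positivity) (abs_nonneg _)).1 h1
  rw [← h2, Quaternion.finrank_eq_four]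
  exact zero_le_one

lemma lintegral_HH_mul (c : HH) (hc : c ≠ 0) (f : HH → ℝ≥0∞) (hf : Measurable f) :
    ∫⁻ y, f y = ∫⁻ y, ‖c‖ₑ ^ 4 * f (y * c) := by
  have hdet : |LinearMap.det (LinearMap.mulRight ℝ c)| = ‖c‖ ^ 4 :=
    HH_abs_det _ _ (norm_pos_iff.2 hc) (fun x => by simp [mul_comm])
  have h0 : LinearMap.det (LinearMap.mulRight ℝ c) ≠ 0 := by
    intro h
    rw [h, abs_zero] at hdet
    exact (pow_pos (norm_pos_iff.2 hc) 4).ne hdet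
  have h1 := Measure.map_linearMap_addHaar_eq_smul_addHaar (volume : Measure HH) h0
  have hm : Measurable (fun y : HH => y * c) := (continuous_id.mul continuous_const).measurable
  have h2 : ∫⁻ y, f (y * c) = ∫⁻ y, f y ∂(Measure.map (LinearMap.mulRight ℝ c) volume) := by
    rw [lintegral_map hf (by exact hm)]
    rfl
  rw [lintegral_const_mul _ (by exact hf.comp hm), h2, h1, lintegral_smul_measure, smul_eq_mul, ← mul_assoc,
    abs_inv, hdet]
  have : ‖c‖ₑ ^ 4 * ENNReal.ofReal ((‖c‖ ^ 4)⁻¹) = 1 := by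
    rw [← ofReal_norm, ← ENNReal.ofReal_pow (norm_nonneg _), ← ENNReal.ofReal_mul (by positivity)]
    rw [mul_inv_cancel₀ (by positivity), ENNReal.ofReal_one]
  rw [this, one_mul]

lemma lintegral_HH_inv (f : HH → ℝ≥0∞) :
    ∫⁻ y, f y = ∫⁻ y, (‖y‖ₑ⁻¹) ^ 8 * f (y⁻¹) := by
  have hs : MeasurableSet ({0}ᶜ : Set HH) := (measurableSet_singleton 0).compl
  have key := lintegral_image_eq_lintegral_abs_det_fderiv_mul (volume : Measure HH) hs
    (f := fun y => y⁻¹) (f' := fun x => -((ContinuousLinearMap.mulLeftRight ℝ HH) x⁻¹) x⁻¹)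
    (fun x hx => (hasFDerivAt_inv' hx).hasFDerivWithinAt) (fun x _ y _ h => inv_injective h) f
  have him : (fun y : HH => y⁻¹) '' ({0}ᶜ : Set HH) = {0}ᶜ := by
    ext y
    simp only [Set.mem_image, Set.mem_compl_iff, Set.mem_singleton_iff]
    constructor
    · rintro ⟨x, hx, rfl⟩
      exact inv_ne_zero hx
    · intro h
      exact ⟨y⁻¹, inv_ne_zero h, inv_inv y⟩
  have hae : ({0}ᶜ : Set HH) =ᵐ[volume] Set.univ := by
    rw [ae_eq_univ, compl_compl]
    exact measure_singleton 0
  have hr : ∀ g : HH → ℝ≥0∞, ∫⁻ y in ({0}ᶜ : Set HH), g y = ∫⁻ y, g y := fun g => by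
    rw [setLIntegral_congr hae, setLIntegral_univ]
  rw [him, hr] at key
  rw [key, ← hr (fun y => (‖y‖ₑ⁻¹) ^ 8 * f (y⁻¹))]
  refine setLIntegral_congr_fun hs ?_
  intro x hx
  have hx' : x ≠ 0 := hx
  have hxp := norm_pos_iff.2 hx'
  have hd : |(-((ContinuousLinearMap.mulLeftRight ℝ HH) x⁻¹) x⁻¹).det| = (‖x‖⁻¹ ^ 2) ^ 4 := by
    apply HH_abs_det _ _ (by positivity)
    intro y
    simp
    ring
  simp only
  rw [hd, ← pow_mul, ← ofReal_norm, ← ENNReal.ofReal_inv_of_pos hxp,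
    ENNReal.ofReal_pow (by positivity)]

lemma lintegral_HH_one_sub (f : HH → ℝ≥0∞) :
    ∫⁻ y, f y = ∫⁻ y, 1 * f (1 - y) := by
  simp only [one_mul]
  exact (lintegral_sub_left_eq_self f 1).symm

/-- marginal integral with respect to quaternionic Lebesgue measure -/
noncomputable def LM {W : Type*} (s : Finset W) (F : (W → HH) → ℝ≥0∞) : (W → HH) → ℝ≥0∞ :=
  lmarginal (fun _ => (volume : Measure HH)) s F

lemma LM_insert {W : Type*} (s : Finset W) (F : (W → HH) → ℝ≥0∞) (hF : Measurable F)
    (i : W) (hi : i ∉ s) (x : W → HH) :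
    LM (insert i s) F x = ∫⁻ y, LM s F (Function.update x i y) := by
  unfold LM; rw [lmarginal_insert _ hF hi]

lemma LM_measurable {W : Type*} (s : Finset W) (F : (W → HH) → ℝ≥0∞) (hF : Measurable F) :
    Measurable (LM s F) := by
  unfold LM; exact hF.lmarginal _

lemma LM_mul_left {W : Type*} (s : Finset W) (G F : (W → HH) → ℝ≥0∞) (hF : Measurable F)
    (hG : ∀ x y : W → HH, (∀ i, i ∉ s → x i = y i) → G x = G y) (x : W → HH) :
    LM s (fun x => G x * F x) x = G x * LM s F x := by
  unfold LM lmarginal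
  rw [← lintegral_const_mul]
  · refine lintegral_congr fun y => ?_
    show G _ * F _ = _
    congr 1
    apply hG
    intro i hi
    simp [Function.updateFinset, hi]
  · exact hF.comp measurable_updateFinset

lemma LM_congr {W : Type*} (s : Finset W) (F G : (W → HH) → ℝ≥0∞) (x : W → HH)
    (h : ∀ z : W → HH, (∀ i, i ∉ s → z i = x i) → F z = G z) : LM s F x = LM s G x := by
  unfold LM lmarginal
  refine lintegral_congr fun y => h _ ?_
  intro i hi
  simp [Function.updateFinset, hi]

lemma LM_congr_ae {W : Type*} (s : Finset W) (F G : (W → HH) → ℝ≥0∞) (x : W → HH)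
    (h : ∀ z : W → HH, (∀ i, i ∉ s → z i = x i) → (∀ i, i ∈ s → z i ≠ 0) → F z = G z) :
    LM s F x = LM s G x := by
  unfold LM lmarginal
  have : ∀ᵐ y : (s → HH), ∀ i, y i ≠ 0 := by
    rw [ae_all_iff]
    intro i
    have h1 : ∀ᵐ q : HH, q ≠ 0 := by
      simp [ae_iff]
    exact (Measure.quasiMeasurePreserving_eval (μ := fun _ : s => (volume : Measure HH)) i).ae h1
  refine lintegral_congr_ae ?_
  filter_upwards [this] with y hy
  apply h
  · intro i hi
    simp [Function.updateFinset, hi]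
  · intro i hi
    simp only [Function.updateFinset, hi, dif_pos]
    exact hy ⟨i, hi⟩

lemma LM_dep {W : Type*} (s : Finset W) (F : (W → HH) → ℝ≥0∞) (x x' : W → HH)
    (h : ∀ z z' : W → HH, (∀ i, i ∉ s → z i = x i) → (∀ i, i ∉ s → z' i = x' i) →
      (∀ i, i ∈ s → z i = z' i) → F z = F z') : LM s F x = LM s F x' := by
  unfold LM lmarginal
  refine lintegral_congr fun y => h _ _ ?_ ?_ ?_
  · intro i hi; simp [Function.updateFinset, hi]
  · intro i hi; simp [Function.updateFinset, hi]
  · intro i hi; simp [Function.updateFinset, hi]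

/-- change of variables for marginals -/
lemma LM_change {W : Type*} (φ : HH → HH) (hφ : Measurable φ) (ρ : HH → ℝ≥0∞) (hρ : Measurable ρ)
    (H : ∀ f : HH → ℝ≥0∞, Measurable f → ∫⁻ y, f y = ∫⁻ y, ρ y * f (φ y))
    (F : (W → HH) → ℝ≥0∞) (hF : Measurable F) (s : Finset W) (x : W → HH) :
    LM s F (fun i => φ (x i)) = LM s (fun x => (∏ i ∈ s, ρ (x i)) * F (fun i => φ (x i))) x := by
  have hφ' : Measurable (fun (x : W → HH) i => φ (x i)) := by fun_prop
  have hmeas : ∀ s : Finset W, Measurable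
      (fun x : W → HH => (∏ i ∈ s, ρ (x i)) * F (fun i => φ (x i))) := fun s =>
    (Finset.measurable_prod _ (fun i _ => by fun_prop)).mul (hF.comp hφ')
  induction s using Finset.induction_on generalizing x with
  | empty => simp [LM]
  | insert i s hi ih =>
    rw [LM_insert _ _ hF _ hi, LM_insert _ _ (hmeas _) _ hi, H]
    · refine lintegral_congr fun y => ?_
      have h1 : Function.update (fun i => φ (x i)) i (φ y)
          = fun j => φ (Function.update x i y j) := by
        ext1 j
        by_cases h : j = i
        · subst h; simp
        · simp [h]
      rw [h1, ih]
      simp only [Finset.prod_insert hi, mul_assoc]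
      rw [LM_mul_left s (fun x => ρ (x i)) _ (hmeas s)]
      · simp
      · intro a b hab
        rw [hab i hi]
    · exact (LM_measurable _ _ hF).comp (measurable_update _)


/-- position space integrand -/
noncomputable def FG {W : Type*} [Fintype W] (Γ : SimpleGraph W) (v : W) (x : W → HH) : ℝ≥0∞ :=
  ∏ i, ∏ j, if Γ.Adj i j ∧ i ≠ v ∧ j ≠ v then ‖x i - x j‖ₑ⁻¹ else 1

lemma FG_measurable {W : Type*} [Fintype W] (Γ : SimpleGraph W) (v : W) : Measurable (FG Γ v) := by
  unfold FG
  refine Finset.measurable_prod _ fun i _ => Finset.measurable_prod _ fun j _ => ?_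
  split_ifs
  · fun_prop
  · fun_prop

/-- position space period -/
noncomputable def posInt {W : Type*} [Fintype W] (Γ : SimpleGraph W) (v u w : W) : ℝ≥0∞ :=
  LM (Finset.univ \ {v, u, w}) (FG Γ v) (Pi.single w 1)

lemma enorm_inv_sub_inv (x y : HH) (hx : x ≠ 0) (hy : y ≠ 0) :
    ‖x⁻¹ - y⁻¹‖ₑ⁻¹ = ‖x - y‖ₑ⁻¹ * (‖x‖ₑ * ‖y‖ₑ) := by
  have h : x⁻¹ - y⁻¹ = x⁻¹ * (y - x) * y⁻¹ := by
    rw [mul_sub, sub_mul, mul_assoc, mul_inv_cancel₀ hy, inv_mul_cancel₀ hx]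
    simp
  rw [h, enorm_mul, enorm_mul, enorm_inv hx, enorm_inv hy, enorm_sub_rev y x]
  rw [ENNReal.mul_inv (Or.inr (by simp [hy])) (Or.inr (by simp)), ENNReal.mul_inv (by simp) (Or.inl (by simp [hx])),
    inv_inv, inv_inv]
  ring

lemma prod_adj_const {W : Type*} [Fintype W] (Γ : SimpleGraph W)
    (hreg : ∀ w : W, Nat.card (Γ.neighborSet w) = 4) (i : W) (a : ℝ≥0∞) :
    (∏ j, if Γ.Adj i j then a else 1) = a ^ 4 := by
  rw [Finset.prod_ite, Finset.prod_const_one, mul_one, Finset.prod_const]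
  congr 1
  rw [← hreg i, Nat.card_eq_fintype_card, Fintype.card_subtype]
  congr 1

lemma sum_adj {W : Type*} [Fintype W] (Γ : SimpleGraph W)
    (hreg : ∀ w : W, Nat.card (Γ.neighborSet w) = 4) (i : W) :
    (∑ j, if Γ.Adj i j then 1 else 0) = 4 := by
  rw [Finset.sum_boole, ← hreg i, Nat.card_eq_fintype_card, Fintype.card_subtype]
  simp

lemma posInt_inv {W : Type*} [Fintype W] (Γ : SimpleGraph W)
    (hreg : ∀ w : W, Nat.card (Γ.neighborSet w) = 4) (v u w : W)
    (hvu : v ≠ u) (hvw : v ≠ w) (huw : u ≠ w) : posInt Γ v u w = posInt Γ u v w := by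
  have hset : (Finset.univ \ {u, v, w} : Finset W) = Finset.univ \ {v, u, w} := by
    ext i; simp; tauto
  unfold posInt
  rw [hset]
  set s := (Finset.univ \ {v, u, w} : Finset W) with hs
  have hx : (Pi.single w 1 : W → HH) = fun i => ((Pi.single w 1 : W → HH) i)⁻¹ := by
    ext1 i
    by_cases h : i = w
    · subst h; simp
    · simp [h]
  conv_lhs => rw [hx]
  rw [LM_change (fun y => y⁻¹) (by fun_prop) (fun y => (‖y‖ₑ⁻¹) ^ 8) (by fun_prop)
    (fun f _ => lintegral_HH_inv f) _ (FG_measurable Γ v)]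
  refine LM_congr_ae _ _ _ _ fun z hz1 hz2 => ?_
  have hzu : z u = 0 := by rw [hz1 u (by simp [hs])]; simp [huw]
  have hzv : z v = 0 := by rw [hz1 v (by simp [hs])]; simp [hvw]
  have hzw : z w = 1 := by rw [hz1 w (by simp [hs])]; simp
  have hz0 : ∀ i, i ≠ u → i ≠ v → z i ≠ 0 := by
    intro i h1 h2
    by_cases h3 : i = w
    · subst h3; rw [hzw]; exact one_ne_zero
    · exact hz2 i (by simp [hs, h1, h2, h3])
  set b : W → ℝ≥0∞ := fun i => if i = u ∨ i = v then 1 else ‖z i‖ₑ with hb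
  have hb0 : ∀ i, b i ≠ 0 := by
    intro i
    simp only [hb]
    split_ifs with h
    · exact one_ne_zero
    · push Not at h
      simp [hz0 i h.1 h.2]
  have hbt : ∀ i, b i ≠ ∞ := by
    intro i
    simp only [hb]
    split_ifs with h
    · simp
    · simp
  have hP : ∏ i ∈ s, (‖z i‖ₑ⁻¹) ^ 8 = ∏ i, ((b i)⁻¹) ^ 8 := by
    have : ∀ i ∈ s, (‖z i‖ₑ⁻¹) ^ 8 = ((b i)⁻¹) ^ 8 := by
      intro i hi
      simp only [hs, Finset.mem_sdiff, Finset.mem_insert, Finset.mem_singleton, not_or] at hi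
      simp [hb, hi.2.1, hi.2.2.1]
    rw [Finset.prod_congr rfl this]
    apply Finset.prod_subset (Finset.subset_univ _)
    intro i _ hi
    have : i = v ∨ i = u ∨ i = w := by
      by_contra hcon
      exact hi (by simpa [hs] using hcon)
    rcases this with rfl | rfl | rfl
    · simp [hb]
    · simp [hb]
    · simp [hb, hzw]
  have hterm : ∀ i j, (if Γ.Adj i j ∧ i ≠ v ∧ j ≠ v then ‖(z i)⁻¹ - (z j)⁻¹‖ₑ⁻¹ else 1)
      = (if Γ.Adj i j ∧ i ≠ u ∧ j ≠ u then ‖z i - z j‖ₑ⁻¹ else 1) *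
        ((if Γ.Adj i j then b i else 1) * (if Γ.Adj i j then b j else 1)) := by
    intro i j
    by_cases hij : Γ.Adj i j
    swap
    · simp [hij]
    have hne := hij.ne
    simp only [hij, true_and, if_true]
    by_cases hiu : i = u
    · subst hiu
      by_cases hjv : j = v
      · subst hjv
        simp [hb]
      · have := hz0 j hne.symm hjv
        simp [hb, hjv, hne.symm, hvu.symm, hzu, enorm_inv this]
    by_cases hiv : i = v
    · subst hiv
      by_cases hju : j = u
      · subst hju
        simp [hb]
      · have := hz0 j hju hne.symm
        simp [hb, hju, hne.symm, hvu, hzv, ENNReal.inv_mul_cancel (a := ‖z j‖ₑ) (by simp [this]) (by simp)]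
    have hi0 := hz0 i hiu hiv
    by_cases hju : j = u
    · subst hju
      simp [hb, hiu, hiv, hvu.symm, hzu, enorm_inv hi0]
    by_cases hjv : j = v
    · subst hjv
      simp [hb, hiu, hiv, hvu, hzv, ENNReal.inv_mul_cancel (a := ‖z i‖ₑ) (by simp [hi0]) (by simp)]
    have hj0 := hz0 j hju hjv
    simp [hb, hiu, hiv, hju, hjv, enorm_inv_sub_inv _ _ hi0 hj0]
  rw [hP]
  unfold FG
  simp_rw [hterm, Finset.prod_mul_distrib]
  have h2 : (∏ i, ∏ j, if Γ.Adj i j then b j else 1) = ∏ i, (b i) ^ 4 := by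
    rw [Finset.prod_comm]
    refine Finset.prod_congr rfl fun i _ => ?_
    rw [← prod_adj_const Γ hreg i]
    simp_rw [Γ.adj_comm i]
  have h1 : (∏ i, ∏ j, if Γ.Adj i j then b i else 1) = ∏ i, (b i) ^ 4 :=
    Finset.prod_congr rfl fun i _ => prod_adj_const Γ hreg i _
  rw [h1, h2, ← Finset.prod_mul_distrib, mul_comm, mul_assoc, ← Finset.prod_mul_distrib]
  have : ∀ i, b i ^ 4 * b i ^ 4 * ((b i)⁻¹) ^ 8 = 1 := by
    intro i
    rw [← pow_add, ← mul_pow, ENNReal.mul_inv_cancel (hb0 i) (hbt i), one_pow]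
  simp [this]

lemma FG_congr {W : Type*} [Fintype W] (Γ : SimpleGraph W) (v : W) (x y : W → HH)
    (h : ∀ i, i ≠ v → x i = y i) : FG Γ v x = FG Γ v y := by
  unfold FG
  refine Finset.prod_congr rfl fun i _ => Finset.prod_congr rfl fun j _ => ?_
  split_ifs with hh
  · rw [h i hh.2.1, h j hh.2.2]
  · rfl

lemma posInt_refl {W : Type*} [Fintype W] (Γ : SimpleGraph W) (v u w : W)
    (hvu : v ≠ u) (hvw : v ≠ w) (huw : u ≠ w) : posInt Γ v u w = posInt Γ v w u := by
  have hset : (Finset.univ \ {v, w, u} : Finset W) = Finset.univ \ {v, u, w} := by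
    ext i; simp; tauto
  unfold posInt
  rw [hset]
  set s := (Finset.univ \ {v, u, w} : Finset W) with hs
  have h1 : LM s (FG Γ v) (Pi.single w 1) =
      LM s (FG Γ v) (fun i => 1 - (Pi.single u 1 : W → HH) i) := by
    refine LM_dep _ _ _ _ fun z z' hz hz' hzz => FG_congr _ _ _ _ fun i hi => ?_
    by_cases his : i ∈ s
    · exact hzz i his
    · rw [hz i his, hz' i his]
      have : i = u ∨ i = w := by
        by_contra hcon
        push Not at hcon
        exact his (by simp [hs, hi, hcon])
      rcases this with rfl | rfl
      · simp [huw]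
      · simp [huw.symm]
  rw [h1, LM_change (fun y => 1 - y) (by fun_prop) (fun y => 1) (by fun_prop)
    (fun f _ => lintegral_HH_one_sub f) _ (FG_measurable Γ v)]
  refine LM_congr _ _ _ _ fun z _ => ?_
  simp only [Finset.prod_const_one, one_mul]
  unfold FG
  refine Finset.prod_congr rfl fun i _ => Finset.prod_congr rfl fun j _ => ?_
  rw [sub_sub_sub_cancel_left, enorm_sub_rev]

lemma FG_count {W : Type*} [Fintype W] (Γ : SimpleGraph W)
    (hreg : ∀ w : W, Nat.card (Γ.neighborSet w) = 4) (v : W) :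
    (∑ i, ∑ j, if Γ.Adj i j ∧ i ≠ v ∧ j ≠ v then 1 else 0) + 8 = 4 * Fintype.card W := by
  have h : ∀ i j, (if Γ.Adj i j ∧ i ≠ v ∧ j ≠ v then 1 else 0) +
      ((if i = v then (if Γ.Adj i j then 1 else 0) else 0) +
       (if j = v then (if Γ.Adj i j then 1 else 0) else 0)) = if Γ.Adj i j then 1 else 0 := by
    intro i j
    by_cases hij : Γ.Adj i j
    · have := hij.ne
      by_cases h1 : i = v
      · have : j ≠ v := by rintro rfl; exact this h1
        simp [hij, h1, this]
      · by_cases h2 : j = v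
        · simp [hij, h1, h2]
        · simp [hij, h1, h2]
    · simp [hij]
  have hA : (∑ i, ∑ j, if Γ.Adj i j then 1 else 0) = 4 * Fintype.card W := by
    simp_rw [sum_adj Γ hreg]
    simp [mul_comm]
  rw [← hA]
  rw [Finset.sum_congr rfl fun i _ => Finset.sum_congr rfl fun j _ => (h i j).symm]
  simp_rw [Finset.sum_add_distrib]
  congr 1
  have h1 : (∑ i, ∑ j, if i = v then (if Γ.Adj i j then 1 else 0) else 0) = 4 := by
    rw [Finset.sum_eq_single v]
    · simp only [if_true]; exact sum_adj Γ hreg v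
    · intro i _ hi; simp [hi]
    · simp
  have h2 : (∑ i, ∑ j, if j = v then (if Γ.Adj i j then 1 else 0) else 0) = 4 := by
    rw [Finset.sum_comm, Finset.sum_eq_single v]
    · simp only [if_true]; simp_rw [Γ.adj_comm _ v]; exact sum_adj Γ hreg v
    · intro i _ hi; simp [hi]
    · simp
  rw [h1, h2]

lemma prod_prod_ite_pow {W : Type*} [Fintype W] (P : W → W → Prop)
    [∀ i j, Decidable (P i j)] (a : ℝ≥0∞) :
    (∏ i, ∏ j, if P i j then a else 1) = a ^ (∑ i, ∑ j, if P i j then 1 else 0) := by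
  simp_rw [← Finset.prod_pow_eq_pow_sum]
  refine Finset.prod_congr rfl fun i _ => Finset.prod_congr rfl fun j _ => ?_
  split_ifs <;> simp

lemma FG_mul {W : Type*} [Fintype W] (Γ : SimpleGraph W)
    (hreg : ∀ w : W, Nat.card (Γ.neighborSet w) = 4) (v : W) (x : W → HH) (q : HH) (hq : q ≠ 0) :
    FG Γ v (fun i => x i * q) = (‖q‖ₑ⁻¹) ^ (4 * Fintype.card W - 8) * FG Γ v x := by
  have hN : (∑ i, ∑ j, if Γ.Adj i j ∧ i ≠ v ∧ j ≠ v then 1 else 0) = 4 * Fintype.card W - 8 := by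
    have := FG_count Γ hreg v
    omega
  rw [← hN, ← prod_prod_ite_pow]
  unfold FG
  simp_rw [← Finset.prod_mul_distrib]
  refine Finset.prod_congr rfl fun i _ => Finset.prod_congr rfl fun j _ => ?_
  split_ifs
  · rw [← sub_mul, enorm_mul, ENNReal.mul_inv (by simp) (by simp), mul_comm]
  · simp

lemma posInt_move {W : Type*} [Fintype W] (Γ : SimpleGraph W)
    (hreg : ∀ w : W, Nat.card (Γ.neighborSet w) = 4) (v u w w' : W)
    (hvu : v ≠ u) (hvw : v ≠ w) (huw : u ≠ w) (hvw' : v ≠ w') (huw' : u ≠ w') :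
    posInt Γ v u w = posInt Γ v u w' := by
  by_cases hww : w = w'
  · rw [hww]
  set s := (Finset.univ \ {v, u, w, w'} : Finset W) with hs
  have hs1 : (Finset.univ \ {v, u, w} : Finset W) = insert w' s := by
    ext i
    by_cases h : i = w'
    · subst h; simp [hvw'.symm, huw'.symm, Ne.symm hww]
    · simp [hs, h]
  have hs2 : (Finset.univ \ {v, u, w'} : Finset W) = insert w s := by
    ext i
    by_cases h : i = w
    · subst h; simp [hvw.symm, huw.symm, hww]
    · simp [hs, h]
  have hcard : s.card + 4 = Fintype.card W := by
    have h4 : ({v, u, w, w'} : Finset W).card = 4 := by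
      rw [Finset.card_insert_of_notMem, Finset.card_insert_of_notMem, Finset.card_insert_of_notMem,
        Finset.card_singleton] <;> simp [*]
    rw [hs, Finset.card_sdiff_of_subset (Finset.subset_univ _), h4, Finset.card_univ]
    have := Finset.card_le_univ ({v, u, w, w'} : Finset W)
    omega
  unfold posInt
  rw [hs1, hs2, LM_insert _ _ (FG_measurable Γ v) _ (by simp [hs]),
    LM_insert _ _ (FG_measurable Γ v) _ (by simp [hs]), lintegral_HH_inv
    (fun y => LM s (FG Γ v) (Function.update (Pi.single w' 1) w y))]
  have h1 : ∀ᵐ q : HH, q ≠ 0 := by simp [ae_iff]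
  refine lintegral_congr_ae ?_
  filter_upwards [h1] with q hq
  have hx : (Function.update (Pi.single w 1) w' q : W → HH) =
      fun i => (Function.update (Pi.single w' 1) w q⁻¹ : W → HH) i * q := by
    ext1 i
    by_cases h : i = w
    · subst h; simp [hww, hq]
    · by_cases h' : i = w'
      · subst h'; simp [h]
      · simp [h, h']
  rw [hx, LM_change (fun y => y * q) (by fun_prop) (fun y => ‖q‖ₑ ^ 4) (by fun_prop)
    (fun f hf => lintegral_HH_mul q hq f hf) _ (FG_measurable Γ v)]
  simp_rw [FG_mul Γ hreg v _ q hq, Finset.prod_const, ← mul_assoc]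
  rw [LM_mul_left s (fun _ => (‖q‖ₑ ^ 4) ^ s.card * ‖q‖ₑ⁻¹ ^ (4 * Fintype.card W - 8)) _
    (FG_measurable Γ v) (fun _ _ _ => rfl)]
  congr 1
  have : 4 * Fintype.card W - 8 = 4 * s.card + 8 := by omega
  rw [this, pow_add, ← mul_assoc, ← pow_mul, ← mul_pow,
    ENNReal.mul_inv_cancel (by simp [hq]) (by simp), one_pow, one_mul]

lemma posInt_indep {W : Type*} [Fintype W] (Γ : SimpleGraph W)
    (hreg : ∀ w : W, Nat.card (Γ.neighborSet w) = 4) (v u w v' u' w' : W)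
    (hvu : v ≠ u) (hvw : v ≠ w) (huw : u ≠ w) (hvu' : v' ≠ u') (hvw' : v' ≠ w') (huw' : u' ≠ w') :
    posInt Γ v u w = posInt Γ v' u' w' := by
  have hc : 2 < Fintype.card W := by
    rw [Fintype.two_lt_card_iff]
    exact ⟨v, u, w, hvu, hvw, huw⟩
  have ex : ∀ a b : W, ∃ c, a ≠ c ∧ b ≠ c := by
    intro a b
    have : ∃ c, c ∉ ({a, b} : Finset W) := by
      by_contra hcon
      push Not at hcon
      have h1 : Fintype.card W ≤ ({a, b} : Finset W).card := by
        rw [← Finset.card_univ]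
        exact Finset.card_le_card (fun c _ => hcon c)
      have h2 : ({a, b} : Finset W).card ≤ 2 := Finset.card_le_two
      omega
    obtain ⟨c, hc⟩ := this
    simp only [Finset.mem_insert, Finset.mem_singleton, not_or] at hc
    exact ⟨c, Ne.symm hc.1, Ne.symm hc.2⟩
  choose t ht1 ht2 using ex
  -- Q
  have hmove : ∀ a b c, a ≠ b → a ≠ c → b ≠ c → posInt Γ a b c = posInt Γ a b (t a b) :=
    fun a b c h1 h2 h3 => posInt_move Γ hreg a b c _ h1 h2 h3 (ht1 a b) (ht2 a b)
  have hsymm : ∀ a b, a ≠ b → posInt Γ a b (t a b) = posInt Γ b a (t b a) := by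
    intro a b hab
    rw [posInt_inv Γ hreg a b _ hab (ht1 a b) (ht2 a b),
      hmove b a _ hab.symm (ht2 a b) (ht1 a b)]
  have hsnd : ∀ a b c, a ≠ b → a ≠ c → posInt Γ a b (t a b) = posInt Γ a c (t a c) := by
    intro a b c hab hac
    by_cases hbc : b = c
    · rw [hbc]
    rw [← hmove a b c hab hac hbc, posInt_refl Γ a b c hab hac hbc,
      hmove a c b hac hab (Ne.symm hbc)]
  rw [hmove _ _ _ hvu hvw huw, hmove _ _ _ hvu' hvw' huw']
  by_cases h : v = v'
  · subst h
    exact hsnd _ _ _ hvu hvu'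
  · rw [hsnd v u v' hvu h, hsymm v v' h, hsnd v' v u' (Ne.symm h) hvu']


lemma lmarginal_prod {ι X : Type*} [MeasurableSpace X] (μ : Measure X) [SigmaFinite μ]
    (f : ι → X → ℝ≥0∞) (hf : ∀ i, Measurable (f i)) (s : Finset ι) (x : ι → X) :
    lmarginal (fun _ => μ) s (fun x => ∏ i ∈ s, f i (x i)) x = ∏ i ∈ s, ∫⁻ y, f i y ∂μ := by
  have hm : ∀ s : Finset ι, Measurable (fun x : ι → X => ∏ i ∈ s, f i (x i)) := fun s =>
    Finset.measurable_prod _ (fun i _ => (hf i).comp (measurable_pi_apply i))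
  induction s using Finset.induction_on generalizing x with
  | empty => simp
  | insert i s hi ih =>
    rw [lmarginal_insert _ (hm _) hi, Finset.prod_insert hi, ← lintegral_mul_const _ (hf i)]
    refine lintegral_congr fun y => ?_
    rw [← ih (Function.update x i y)]
    unfold lmarginal
    rw [← lintegral_const_mul _ (by exact (hm s).comp measurable_updateFinset)]
    refine lintegral_congr fun z => ?_
    beta_reduce
    rw [Finset.prod_insert hi]
    congr 1
    simp [Function.updateFinset, hi]

lemma lintegral_pi_prod {ι X : Type*} [Fintype ι] [MeasurableSpace X] (μ : Measure X) [SigmaFinite μ]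
    (f : ι → X → ℝ≥0∞) (hf : ∀ i, Measurable (f i)) :
    ∫⁻ x, ∏ i, f i (x i) ∂(Measure.pi fun _ : ι => μ) = ∏ i, ∫⁻ y, f i y ∂μ := by
  rcases isEmpty_or_nonempty X with hX | ⟨⟨x0⟩⟩
  · rcases isEmpty_or_nonempty ι with hi | ⟨⟨i0⟩⟩
    · simp
    · haveI : IsEmpty (ι → X) := ⟨fun g => hX.elim (g i0)⟩
      rw [lintegral_of_isEmpty, eq_comm, Finset.prod_eq_zero (Finset.mem_univ i0)]
      rw [lintegral_of_isEmpty]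
  · rw [lintegral_eq_lmarginal_univ (fun _ => x0)]
    exact lmarginal_prod μ f hf Finset.univ _

/-- matrix acting on quaternionic vectors -/
noncomputable def matAct {n : Type*} [Fintype n] (C : Matrix n n ℝ) : (n → HH) →ₗ[ℝ] (n → HH) where
  toFun x k := ∑ i, C k i • x i
  map_add' x y := by ext1 k; simp [Finset.sum_add_distrib]
  map_smul' c x := by
    ext1 k
    simp only [Pi.smul_apply, Finset.smul_sum, RingHom.id_apply]
    exact Finset.sum_congr rfl fun i _ => smul_comm _ _ _

/-- coordinates of quaternions -/
noncomputable def tupEquiv : HH ≃ₗ[ℝ] (Fin 4 → ℝ) :=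
  QuaternionAlgebra.linearEquivTuple (-1 : ℝ) (0 : ℝ) (-1 : ℝ)

/-- transposition of coordinates -/
noncomputable def transEquiv (n : Type*) : (n → HH) ≃ₗ[ℝ] (Fin 4 → n → ℝ) where
  toFun x k i := tupEquiv (x i) k
  invFun y i := tupEquiv.symm (fun k => y k i)
  map_add' x y := by ext k i; simp
  map_smul' c x := by ext k i; simp
  left_inv x := by ext1 i; simp
  right_inv y := by ext k i; simp

lemma det_matAct {n : Type*} [Fintype n] [DecidableEq n] (C : Matrix n n ℝ) :
    LinearMap.det (matAct C) = C.det ^ 4 := by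
  rw [← LinearMap.det_conj (matAct C) (transEquiv n)]
  have : (transEquiv n : (n → HH) →ₗ[ℝ] _) ∘ₗ matAct C ∘ₗ ((transEquiv n).symm : _ →ₗ[ℝ] _)
      = LinearMap.pi fun k : Fin 4 => (Matrix.toLin' C) ∘ₗ LinearMap.proj k := by
    apply LinearMap.ext
    intro y
    ext k i
    simp [transEquiv, matAct, Matrix.mulVec, dotProduct, map_sum]
  rw [this, LinearMap.det_pi]
  simp

lemma lintegral_matAct {n : Type*} [Fintype n] [DecidableEq n] (C : Matrix n n ℝ) (hC : C.det ≠ 0)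
    (f : (n → HH) → ℝ≥0∞) (hf : Measurable f) :
    ∫⁻ x, f (matAct C x) = ENNReal.ofReal ((C.det ^ 4)⁻¹) * ∫⁻ x, f x := by
  have h0 : LinearMap.det (matAct C) ≠ 0 := by rw [det_matAct]; positivity
  have h1 := Measure.map_linearMap_addHaar_eq_smul_addHaar (volume : Measure (n → HH)) h0
  rw [det_matAct, abs_of_nonneg (by positivity)] at h1
  rw [← smul_eq_mul, ← lintegral_smul_measure, ← h1, lintegral_map hf]
  exact (LinearMap.continuous_of_finiteDimensional _).measurable

/-- Gaussian normalization -/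
noncomputable def gC : ℝ≥0∞ := ∫⁻ y : HH, ENNReal.ofReal (Real.exp (-‖y‖ ^ 2))

open scoped MatrixOrder in
lemma gauss_integral {n : Type*} [Fintype n] [DecidableEq n] (A : Matrix n n ℝ) (hA : A.PosSemidef)
    (hd : A.det ≠ 0) :
    ∫⁻ x : n → HH, ENNReal.ofReal (Real.exp (-∑ i, ∑ j, A i j * inner ℝ (x i) (x j)))
      = ENNReal.ofReal ((A.det ^ 2)⁻¹) * gC ^ Fintype.card n := by
  obtain ⟨C, rfl⟩ := CStarAlgebra.nonneg_iff_eq_star_mul_self.mp hA.nonneg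
  have hdet : (star C * C).det = C.det ^ 2 := by
    rw [Matrix.det_mul, Matrix.star_eq_conjTranspose, Matrix.det_conjTranspose]
    simp [sq]
  rw [hdet] at hd ⊢
  have hC : C.det ≠ 0 := fun h => hd (by rw [h]; simp)
  have hq : ∀ x : n → HH, ∑ i, ∑ j, (star C * C) i j * inner ℝ (x i) (x j)
      = ∑ k, ‖matAct C x k‖ ^ 2 := by
    intro x
    have : ∀ k, ‖matAct C x k‖ ^ 2 = ∑ i, ∑ j, (C k i * C k j) * inner ℝ (x i) (x j) := by
      intro k
      rw [← real_inner_self_eq_norm_sq]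
      simp only [matAct, LinearMap.coe_mk, AddHom.coe_mk, sum_inner, inner_sum]
      refine Finset.sum_congr rfl fun i _ => Finset.sum_congr rfl fun j _ => ?_
      rw [real_inner_smul_left, real_inner_smul_right, real_inner_comm]
      first | ring | (rw [real_inner_comm]; ring)
    have h2 : ∀ i j, (star C * C) i j = ∑ k, C k i * C k j := by
      intro i j
      rw [Matrix.mul_apply]
      simp [Matrix.star_apply]
    simp only [this, h2, Finset.sum_mul]
    conv_rhs => rw [Finset.sum_comm]
    refine Finset.sum_congr rfl fun i _ => ?_
    conv_rhs => rw [Finset.sum_comm]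
  simp_rw [hq]
  have hm : ∀ k : n, Measurable (fun y : HH => ENNReal.ofReal (Real.exp (-‖y‖ ^ 2))) := fun k => by
    fun_prop
  rw [lintegral_matAct C hC (fun y => ENNReal.ofReal (Real.exp (-∑ k, ‖y k‖ ^ 2)))
    (by fun_prop)]
  congr 1
  · rw [← pow_mul]
  · have : ∀ y : n → HH, ENNReal.ofReal (Real.exp (-∑ k, ‖y k‖ ^ 2))
        = ∏ k, ENNReal.ofReal (Real.exp (-‖y k‖ ^ 2)) := by
      intro y
      rw [← ENNReal.ofReal_prod_of_nonneg (fun _ _ => (Real.exp_pos _).le), ← Real.exp_sum,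
        Finset.sum_neg_distrib]
    simp_rw [this]
    exact (lintegral_pi_prod (volume : Measure HH) (fun _ y => ENNReal.ofReal (Real.exp (-‖y‖ ^ 2)))
      hm).trans (by simp [gC])

lemma gC_scale (a : ℝ) (ha : 0 < a) :
    ∫⁻ y : HH, ENNReal.ofReal (Real.exp (-(a * ‖y‖ ^ 2))) = ENNReal.ofReal ((a ^ 2)⁻¹) * gC := by
  have hs : (algebraMap ℝ HH (Real.sqrt a)) ≠ 0 := by
    intro h
    have h1 := congrArg norm h
    rw [norm_algebraMap', Real.norm_of_nonneg (Real.sqrt_nonneg a), norm_zero] at h1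
    exact (Real.sqrt_pos.2 ha).ne' h1
  have hn : ‖(algebraMap ℝ HH (Real.sqrt a))‖ = Real.sqrt a := by
    rw [norm_algebraMap', Real.norm_of_nonneg (Real.sqrt_nonneg a)]
  rw [gC, lintegral_HH_mul _ hs (fun y : HH => ENNReal.ofReal (Real.exp (-‖y‖ ^ 2))) (by fun_prop),
    lintegral_const_mul _ (by fun_prop), ← mul_assoc]
  have : ENNReal.ofReal ((a ^ 2)⁻¹) * ‖(algebraMap ℝ HH (Real.sqrt a))‖ₑ ^ 4 = 1 := by
    rw [← ofReal_norm, hn, ← ENNReal.ofReal_pow (Real.sqrt_nonneg a),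
      ← ENNReal.ofReal_mul (by positivity)]
    have : Real.sqrt a ^ 4 = a ^ 2 := by
      rw [show 4 = 2 * 2 from rfl, pow_mul, Real.sq_sqrt ha.le]
    rw [this, inv_mul_cancel₀ (by positivity), ENNReal.ofReal_one]
  rw [this, one_mul]
  refine lintegral_congr fun y => ?_
  rw [norm_mul, hn, mul_pow, Real.sq_sqrt ha.le, mul_comm]

lemma gC_ne_zero : gC ≠ 0 := by
  unfold gC
  rw [← pos_iff_ne_zero, lintegral_pos_iff_support (by fun_prop)]
  have : (Function.support fun y : HH => ENNReal.ofReal (Real.exp (-‖y‖ ^ 2))) = Set.univ := by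
    ext y; simp [Real.exp_pos]
  rw [this]
  simp

lemma gC_ne_top : gC ≠ ∞ := by
  have h := GaussianFourier.integrable_cexp_neg_mul_sq_norm_add (b := 1) (by simp) 0 (0 : HH)
  have h2 : Integrable (fun y : HH => Real.exp (-‖y‖ ^ 2)) := by
    have := h.norm
    refine this.congr (Filter.Eventually.of_forall fun y => ?_)
    simp [Complex.norm_exp]
    norm_cast
  have := h2.hasFiniteIntegral
  rw [hasFiniteIntegral_iff_ofReal (Filter.Eventually.of_forall fun y => (Real.exp_pos _).le)] at this
  exact this.ne


/-- coefficients of the Cauchy-Binet expansion -/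
noncomputable def cbT {n E : Type*} [Fintype n] [DecidableEq n] [Fintype E] (M : n → E → ℝ) (S : Finset E) : ℝ :=
  ∑ f : n → E, if Function.Injective f ∧ Finset.image f Finset.univ = S then
    (∏ i, M i (f i)) * Matrix.det (Matrix.of fun i j => M j (f i)) else 0

lemma cb_expand {n E : Type*} [Fintype n] [DecidableEq n] [Fintype E] (M : n → E → ℝ) (α : E → ℝ) :
    Matrix.det (Matrix.of fun i j => ∑ e, M i e * α e * M j e) = ∑ S : Finset E, cbT M S * ∏ e ∈ S, α e := by
  have h1 : Matrix.det (Matrix.of fun i j => ∑ e, M i e * α e * M j e)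
      = ∑ f : n → E, (∏ i, (M i (f i) * α (f i))) * Matrix.det (Matrix.of fun i j => M j (f i)) := by
    have := (Matrix.detRowAlternating (n := n) (R := ℝ)).toMultilinearMap.map_sum
      (fun i (e : E) => (M i e * α e) • (fun j => M j e))
    have h2 : (fun i => ∑ e, (M i e * α e) • (fun j => M j e))
        = (fun i j => ∑ e, M i e * α e * M j e) := by
      ext i j; simp [Finset.sum_apply]
    rw [h2] at this
    refine this.trans (Finset.sum_congr rfl fun f _ => ?_)
    have := (Matrix.detRowAlternating (n := n) (R := ℝ)).toMultilinearMap.map_smul_univ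
      (fun i => M i (f i) * α (f i)) (fun i j => M j (f i))
    exact this
  rw [h1]
  simp only [cbT, Finset.sum_mul]
  rw [Finset.sum_comm]
  refine Finset.sum_congr rfl fun f _ => ?_
  by_cases hf : Function.Injective f
  · rw [Finset.sum_eq_single (Finset.image f Finset.univ)]
    · rw [if_pos ⟨hf, rfl⟩, Finset.prod_image (fun a _ b _ h => hf h), Finset.prod_mul_distrib]
      ring
    · intro S _ hS
      rw [if_neg (fun h => hS h.2.symm), zero_mul]
    · simp
  · rw [Finset.sum_eq_zero]
    · simp only [Function.Injective, not_forall] at hf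
      obtain ⟨a, b, hab, hne⟩ := hf
      rw [Matrix.det_zero_of_row_eq hne (by ext j; simp [hab]), mul_zero]
    · intro S _
      rw [if_neg (fun h => hf h.1), zero_mul]

lemma cbT_card {n E : Type*} [Fintype n] [DecidableEq n] [Fintype E] (M : n → E → ℝ) (S : Finset E)
    (h : S.card ≠ Fintype.card n) : cbT M S = 0 := by
  refine Finset.sum_eq_zero fun f _ => ?_
  rw [if_neg]
  rintro ⟨h1, rfl⟩
  exact h (by rw [Finset.card_image_of_injective _ h1, Finset.card_univ])

lemma cbT_sq {n E : Type*} [Fintype n] [DecidableEq n] [Fintype E] (M : n → E → ℝ) (S : Finset E)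
    (g : n ≃ S) : cbT M S = (Matrix.det (Matrix.of fun i j => M i (g j))) ^ 2 := by
  have hc : S.card = Fintype.card n := by rw [Fintype.card_congr g]; simp
  have h1 := cb_expand M (fun e => if e ∈ S then 1 else 0)
  rw [Finset.sum_eq_single S] at h1
  · rw [Finset.prod_eq_one (fun e he => if_pos he), mul_one] at h1
    have h3 : (Matrix.det (Matrix.of fun i j => M i (g j))) ^ 2
        = ((Matrix.of fun i j => M i (g j)) * (Matrix.of fun i j => M i (g j))ᵀ).det := by
      rw [Matrix.det_mul, Matrix.det_transpose, sq]
    rw [← h1, h3]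
    congr 1
    ext i j
    simp only [Matrix.mul_apply, Matrix.transpose_apply, Matrix.of_apply]
    rw [g.sum_comp (fun e : S => M i e * M j e)]
    simp only [mul_ite, mul_one, mul_zero, ite_mul, zero_mul]
    rw [Finset.sum_ite_mem, Finset.univ_inter, ← Finset.sum_coe_sort]
  · intro S' _ hS'
    by_cases h : S' ⊆ S
    · rw [cbT_card, zero_mul]
      intro h'
      exact hS' (Finset.eq_of_subset_of_card_le h (by omega))
    · obtain ⟨e, he, he'⟩ := Finset.not_subset.1 h
      rw [Finset.prod_eq_zero he (if_neg he'), mul_zero]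
  · simp

/-- signed incidence -/
noncomputable def sg {V : Type*} (e : Sym2 V) (i : V) : ℤ :=
  (if i = (Quot.out e).1 then 1 else 0) - (if i = (Quot.out e).2 then 1 else 0)

lemma sym2_out {V : Type*} (e : Sym2 V) : s((Quot.out e).1, (Quot.out e).2) = e := Quot.out_eq e

lemma sg_cases {V : Type*} (a b : V) :
    (∀ i, sg s(a, b) i = (if i = a then 1 else 0) - (if i = b then 1 else 0)) ∨
    (∀ i, sg s(a, b) i = (if i = b then 1 else 0) - (if i = a then 1 else 0)) := by
  have := sym2_out s(a, b)
  rw [Sym2.eq_iff] at this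
  rcases this with ⟨h1, h2⟩ | ⟨h1, h2⟩
  · left; intro i; simp only [sg, h1, h2]
  · right; intro i; simp only [sg, h1, h2]

lemma sg_sum {V : Type*} [Fintype V] (e : Sym2 V) (x : V → ℤ) :
    ∑ i, x i * sg e i = x (Quot.out e).1 - x (Quot.out e).2 := by
  simp [sg, mul_sub, Finset.sum_sub_distrib]

lemma det_conn {V : Type*} [Fintype V] (u : V) {ι : Type*} [Fintype ι] (H : SimpleGraph V)
    (hH : H.Connected) (g : {i // i ≠ u} ≃ ι) (ε : ι → Sym2 V)
    (hε : H.edgeSet ⊆ Set.range ε) :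
    (Matrix.det (Matrix.of fun i j : {i // i ≠ u} => sg (ε (g j)) i.1)) ^ 2 = 1 := by
  have key : ∀ w, ∃ c : {i // i ≠ u} → ℤ, ∀ i : {i // i ≠ u},
      ∑ j, sg (ε (g j)) i.1 * c j = if i.1 = w then 1 else 0 := by
    intro w
    obtain ⟨p⟩ := hH.preconnected w u
    induction p with
    | nil => exact ⟨0, fun i => by simp [i.2]⟩
    | @cons a b u h p ih =>
      obtain ⟨c, hc⟩ := ih g
      obtain ⟨k, hk⟩ := hε (show s(a, b) ∈ H.edgeSet from h)
      rcases sg_cases a b with hs | hs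
      · refine ⟨fun j => c j + if j = g.symm k then 1 else 0, fun i => ?_⟩
        simp only [mul_add, Finset.sum_add_distrib, hc]
        simp [hk, hs]
      · refine ⟨fun j => c j - if j = g.symm k then 1 else 0, fun i => ?_⟩
        simp only [mul_sub, Finset.sum_sub_distrib, hc]
        simp [hk, hs]
  choose c hc using key
  have h1 : (Matrix.of fun i j : {i // i ≠ u} => sg (ε (g j)) i.1) *
      (Matrix.of fun j w : {i // i ≠ u} => c w.1 j) = 1 := by
    ext i w
    simp only [Matrix.mul_apply, Matrix.of_apply, hc, Matrix.one_apply, Subtype.ext_iff]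
  have h2 := congrArg Matrix.det h1
  rw [Matrix.det_mul, Matrix.det_one] at h2
  have h3 := Int.isUnit_iff.1 (IsUnit.of_mul_eq_one _ h2)
  rcases h3 with h | h <;> rw [h] <;> norm_num

lemma det_disconn {V : Type*} [Fintype V] (u : V) {ι : Type*} [Fintype ι] (H : SimpleGraph V)
    (hH : ¬ H.Connected) (g : {i // i ≠ u} ≃ ι) (ε : ι → Sym2 V)
    (hε : Set.range ε ⊆ H.edgeSet) :
    (Matrix.det (Matrix.of fun i j : {i // i ≠ u} => sg (ε (g j)) i.1)) = 0 := by
  have : ∃ w, ¬ H.Reachable w u := by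
    by_contra hcon
    push Not at hcon
    have : Nonempty V := ⟨u⟩
    exact hH ⟨fun a b => (hcon a).trans (hcon b).symm⟩
  obtain ⟨w, hw⟩ := this
  apply Matrix.exists_vecMul_eq_zero_iff.1
  refine ⟨fun i => if H.Reachable i.1 u then 0 else 1, ?_, ?_⟩
  · intro h
    have := congrFun h ⟨w, fun h => hw (h ▸ SimpleGraph.Reachable.refl _)⟩
    simp [hw] at this
  · ext j
    have h1 := sg_sum (ε (g j)) (fun i => if H.Reachable i u then 0 else 1)
    have h2 : H.Adj (Quot.out (ε (g j))).1 (Quot.out (ε (g j))).2 := by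
      rw [← SimpleGraph.mem_edgeSet, sym2_out]
      exact hε ⟨_, rfl⟩
    have h3 : H.Reachable (Quot.out (ε (g j))).1 u ↔ H.Reachable (Quot.out (ε (g j))).2 u :=
      ⟨fun h => h2.symm.reachable.trans h, fun h => h2.reachable.trans h⟩
    simp only [h3, sub_self] at h1
    rw [← Fintype.sum_subtype_add_sum_subtype (fun i => i ≠ u)] at h1
    simp only [Matrix.vecMul, dotProduct, Pi.zero_apply, Matrix.of_apply]
    refine Eq.trans ?_ h1
    rw [eq_comm, add_eq_left]
    refine Finset.sum_eq_zero fun i _ => ?_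
    have : i.1 = u := not_not.1 i.2
    rw [this, if_pos (SimpleGraph.Reachable.refl _), zero_mul]

lemma matrix_tree {V : Type*} [Fintype V] (G : SimpleGraph V) [Fintype G.edgeSet] (u : V)
    (α : G.edgeSet → ℝ) :
    Matrix.det (Matrix.of fun i j : {i // i ≠ u} => ∑ e : G.edgeSet, (sg e.1 i.1 : ℝ) * α e * (sg e.1 j.1 : ℝ))
      = ∑ T : Finset G.edgeSet,
        if (SimpleGraph.fromEdgeSet (Subtype.val '' (T : Set G.edgeSet))).IsTree then
          ∏ e ∈ T, α e else 0 := by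
  have := cb_expand (fun (i : {i // i ≠ u}) (e : G.edgeSet) => (sg e.1 i.1 : ℝ)) α
  refine Eq.trans (b := ∑ S, cbT (fun (i : {i // i ≠ u}) (e : G.edgeSet) => (sg e.1 i.1 : ℝ)) S
    * ∏ e ∈ S, α e) (by convert this) ?_
  refine Finset.sum_congr rfl fun T _ => ?_
  set H := SimpleGraph.fromEdgeSet (Subtype.val '' (T : Set G.edgeSet)) with hH
  have hE : H.edgeSet = Subtype.val '' (T : Set G.edgeSet) := by
    rw [hH, SimpleGraph.edgeSet_fromEdgeSet, sdiff_eq_left, Set.disjoint_left]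
    rintro _ ⟨e, _, rfl⟩ h
    exact G.not_isDiag_of_mem_edgeSet e.2 h
  have hEc : Nat.card H.edgeSet = T.card := by
    rw [hE, Nat.card_image_of_injective Subtype.val_injective]
    simp
  have hVc : Nat.card V = Fintype.card {i // i ≠ u} + 1 := by
    rw [Nat.card_eq_fintype_card, Fintype.card_subtype_compl, Fintype.card_subtype_eq]
    have : 0 < Fintype.card V := Fintype.card_pos_iff.2 ⟨u⟩
    omega
  rw [SimpleGraph.isTree_iff_connected_and_card, hEc, hVc]
  by_cases hT : T.card = Fintype.card {i // i ≠ u}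
  · have g : {i // i ≠ u} ≃ T := Fintype.equivOfCardEq (by simp [hT])
    rw [cbT_sq _ _ g]
    have hcast : (Matrix.det (Matrix.of fun i j : {i // i ≠ u} => ((sg (g j).1.1 i.1 : ℤ) : ℝ)))
        = ((Matrix.det (Matrix.of fun i j : {i // i ≠ u} => sg (g j).1.1 i.1) : ℤ) : ℝ) := by
      rw [Int.cast_det]; rfl
    have hR : H.edgeSet = Set.range (fun e : T => e.1.1) := by
      rw [hE]; ext e; simp
    rw [hcast]
    by_cases hc : H.Connected
    · rw [if_pos ⟨hc, by rw [hT]⟩, ← Int.cast_pow, det_conn u H hc g (fun e => e.1.1) hR.le]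
      simp
    · rw [if_neg (fun h => hc h.1), det_disconn u H hc g (fun e => e.1.1) hR.ge]
      simp
  · rw [cbT_card _ _ hT, zero_mul, if_neg]
    rintro ⟨_, h⟩
    exact hT (by omega)


lemma lintegral_Ioi_deriv (g g' : ℝ → ℝ) (l : ℝ) (hcont : ContinuousWithinAt g (Set.Ici 0) 0)
    (hderiv : ∀ x ∈ Set.Ioi (0 : ℝ), HasDerivAt g (g' x) x)
    (g'pos : ∀ x ∈ Set.Ioi (0 : ℝ), 0 ≤ g' x)
    (hg : Filter.Tendsto g Filter.atTop (nhds l)) :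
    ∫⁻ x in Set.Ioi (0 : ℝ), ENNReal.ofReal (g' x) = ENNReal.ofReal (l - g 0) := by
  rw [← integral_Ioi_of_hasDerivAt_of_nonneg hcont hderiv g'pos hg,
    ofReal_integral_eq_lintegral_ofReal (integrableOn_Ioi_deriv_of_nonneg hcont hderiv g'pos hg)]
  exact (ae_restrict_mem measurableSet_Ioi).mono fun x hx => g'pos x hx

lemma lint_one_add : ∫⁻ x in Set.Ioi (0 : ℝ), ENNReal.ofReal (((1 + x) ^ 2)⁻¹) = 1 := by
  have hd : ∀ x : ℝ, 0 ≤ x → HasDerivAt (fun x : ℝ => -(1 + x)⁻¹) (((1 + x) ^ 2)⁻¹) x := by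
    intro x hx
    have h1 : HasDerivAt (fun x : ℝ => 1 + x) 1 x := (hasDerivAt_id x).const_add 1
    have := (h1.inv (by positivity)).neg
    refine HasDerivAt.congr_deriv this ?_
    ring
  have := lintegral_Ioi_deriv (fun x : ℝ => -(1 + x)⁻¹) (fun x => ((1 + x) ^ 2)⁻¹) 0
    (hd 0 le_rfl).continuousAt.continuousWithinAt (fun x hx => hd x (le_of_lt hx))
    (fun x _ => by positivity) (by
      have : Filter.Tendsto (fun x : ℝ => (1 + x)⁻¹) Filter.atTop (nhds 0) :=
        tendsto_inv_atTop_zero.comp (Filter.tendsto_atTop_add_const_left _ 1 Filter.tendsto_id)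
      simpa using this.neg)
  rw [this]; simp

lemma sch_pos (r : ℝ) (hr : 0 < r) :
    ∫⁻ x in Set.Ioi (0 : ℝ), ENNReal.ofReal ((x ^ 2)⁻¹ * Real.exp (-(x⁻¹ * r)))
      = (ENNReal.ofReal r)⁻¹ := by
  have key := lintegral_Ioi_deriv
    (fun x : ℝ => if x ≤ 0 then 0 else Real.exp (-(x⁻¹ * r)) / r)
    (fun x => (x ^ 2)⁻¹ * Real.exp (-(x⁻¹ * r))) (1 / r) ?_ ?_ (fun x _ => by positivity) ?_
  · rw [key]
    simp only [le_refl, if_true, sub_zero, one_div]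
    rw [ENNReal.ofReal_inv_of_pos hr]
  · rw [← continuousWithinAt_Ioi_iff_Ici]
    unfold ContinuousWithinAt
    simp only [le_refl, if_true]
    have h1 : Filter.Tendsto (fun x : ℝ => x⁻¹ * r) (nhdsWithin 0 (Set.Ioi 0)) Filter.atTop :=
      tendsto_inv_nhdsGT_zero.atTop_mul_const hr
    have h2 : Filter.Tendsto (fun x : ℝ => Real.exp (-(x⁻¹ * r)) / r) (nhdsWithin 0 (Set.Ioi 0))
        (nhds 0) := by
      have := (Real.tendsto_exp_neg_atTop_nhds_zero.comp h1).div_const r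
      simpa using this
    refine h2.congr' ?_
    filter_upwards [self_mem_nhdsWithin] with x hx
    rw [if_neg (not_le.2 hx)]
  · intro x hx
    have hx' : (x : ℝ) ≠ 0 := (ne_of_gt hx)
    have h1 : HasDerivAt (fun x : ℝ => Real.exp (-(x⁻¹ * r)) / r)
        ((x ^ 2)⁻¹ * Real.exp (-(x⁻¹ * r))) x := by
      have := ((((hasDerivAt_inv hx').mul_const r).neg).exp).div_const r
      refine HasDerivAt.congr_deriv this ?_
      simp only [Pi.neg_apply]
      field_simp
    refine h1.congr_of_eventuallyEq ?_
    filter_upwards [Ioi_mem_nhds hx] with y hy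
    rw [if_neg (not_le.2 hy)]
  · have h1 : Filter.Tendsto (fun x : ℝ => Real.exp (-(x⁻¹ * r)) / r) Filter.atTop
        (nhds (Real.exp (-(0 * r)) / r)) :=
      (((Real.continuous_exp.tendsto _).comp ((tendsto_inv_atTop_zero.mul_const r).neg)).div_const r)
    simp only [zero_mul, neg_zero, Real.exp_zero] at h1
    refine h1.congr' ?_
    filter_upwards [Filter.Ioi_mem_atTop (0 : ℝ)] with x hx
    rw [if_neg (not_le.2 hx)]

lemma sch (r : ℝ) (hr : 0 ≤ r) :
    ∫⁻ x in Set.Ioi (0 : ℝ), ENNReal.ofReal ((x ^ 2)⁻¹ * Real.exp (-(x⁻¹ * r)))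
      = (ENNReal.ofReal r)⁻¹ := by
  rcases hr.lt_or_eq with h | rfl
  · exact sch_pos r h
  · simp only [ENNReal.ofReal_zero, ENNReal.inv_zero]
    refine ENNReal.eq_top_of_forall_nnreal_le fun t => ?_
    have ht : (0 : ℝ) < (t + 1 : ℝ)⁻¹ := by positivity
    have h1 := sch_pos _ ht
    have h2 : (t : ℝ≥0∞) ≤ (ENNReal.ofReal (t + 1 : ℝ)⁻¹)⁻¹ := by
      rw [ENNReal.ofReal_inv_of_pos (by positivity), inv_inv, ENNReal.ofReal_add (by simp) (by simp)]
      simp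
    refine h2.trans (h1.symm.le.trans ?_)
    refine setLIntegral_mono' measurableSet_Ioi fun x hx => ENNReal.ofReal_le_ofReal ?_
    have hx' : (0 : ℝ) < x := hx
    refine mul_le_mul_of_nonneg_left (Real.exp_le_exp.2 ?_) (by positivity)
    simp only [mul_zero, neg_zero, Left.neg_nonpos_iff]
    positivity

lemma gK : ∫⁻ c : HH, (ENNReal.ofReal (‖c‖ ^ 2))⁻¹ * ENNReal.ofReal (Real.exp (-‖c‖ ^ 2)) = gC := by
  have h1 : ∀ c : HH, (ENNReal.ofReal (‖c‖ ^ 2))⁻¹ * ENNReal.ofReal (Real.exp (-‖c‖ ^ 2))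
      = ∫⁻ x in Set.Ioi (0 : ℝ), ENNReal.ofReal ((x ^ 2)⁻¹ * Real.exp (-(x⁻¹ * ‖c‖ ^ 2)))
        * ENNReal.ofReal (Real.exp (-‖c‖ ^ 2)) := by
    intro c
    rw [lintegral_mul_const _ (by fun_prop), sch _ (by positivity)]
  simp_rw [h1]
  rw [lintegral_lintegral_swap (by
    apply Measurable.aemeasurable
    unfold Function.uncurry
    fun_prop)]
  have h2 : ∀ x ∈ Set.Ioi (0 : ℝ), (∫⁻ c : HH, ENNReal.ofReal ((x ^ 2)⁻¹ * Real.exp (-(x⁻¹ * ‖c‖ ^ 2)))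
        * ENNReal.ofReal (Real.exp (-‖c‖ ^ 2))) = ENNReal.ofReal (((1 + x) ^ 2)⁻¹) * gC := by
    intro x hx
    have hx' : (0 : ℝ) < x := hx
    have h3 : ∀ c : HH, ENNReal.ofReal ((x ^ 2)⁻¹ * Real.exp (-(x⁻¹ * ‖c‖ ^ 2)))
        * ENNReal.ofReal (Real.exp (-‖c‖ ^ 2))
        = ENNReal.ofReal ((x ^ 2)⁻¹) * ENNReal.ofReal (Real.exp (-((1 + x⁻¹) * ‖c‖ ^ 2))) := by
      intro c
      rw [← ENNReal.ofReal_mul (by positivity), ← ENNReal.ofReal_mul (by positivity), mul_assoc,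
        ← Real.exp_add]
      congr 3
      ring
    simp_rw [h3]
    rw [lintegral_const_mul _ (by fun_prop), gC_scale _ (by positivity), ← mul_assoc,
      ← ENNReal.ofReal_mul (by positivity)]
    congr 2
    field_simp
    ring
  rw [setLIntegral_congr_fun measurableSet_Ioi h2, lintegral_mul_const _ (by fun_prop), lint_one_add,
    one_mul]


/-- tree polynomial -/
noncomputable def phiT {V : Type*} (G : SimpleGraph V) [Fintype G.edgeSet] (α : G.edgeSet → ℝ) : ℝ :=
  ∑ T : Finset G.edgeSet,
    if (SimpleGraph.fromEdgeSet (Subtype.val '' (T : Set G.edgeSet))).IsTree then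
      ∏ e ∈ T, α e else 0

/-- dual tree polynomial -/
noncomputable def psiT {V : Type*} (G : SimpleGraph V) [Fintype G.edgeSet] (α : G.edgeSet → ℝ) : ℝ :=
  ∑ T : Finset G.edgeSet,
    if (SimpleGraph.fromEdgeSet (Subtype.val '' (T : Set G.edgeSet))).IsTree then
      ∏ e ∈ Tᶜ, α e else 0

lemma psi_phi {V : Type*} (G : SimpleGraph V) [Fintype G.edgeSet] (X : G.edgeSet → ℝ)
    (hX : ∀ e, 0 < X e) : psiT G X = (∏ e, X e) * phiT G (fun e => (X e)⁻¹) := by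
  unfold psiT phiT
  rw [Finset.mul_sum]
  refine Finset.sum_congr rfl fun T _ => ?_
  split_ifs
  · rw [← Finset.prod_mul_prod_compl T X, mul_right_comm, ← Finset.prod_mul_distrib,
      Finset.prod_eq_one (fun e _ => mul_inv_cancel₀ (hX e).ne'), one_mul]
  · simp

lemma phi_pos {V : Type*} [Fintype V] (G : SimpleGraph V) (hG : G.Connected) [Fintype G.edgeSet]
    (α : G.edgeSet → ℝ) (hα : ∀ e, 0 < α e) : 0 < phiT G α := by
  obtain ⟨T, hT, hT'⟩ := hG.exists_isTree_le
  refine Finset.sum_pos' (fun S _ => ?_) ⟨Finset.univ.filter (fun e => e.1 ∈ T.edgeSet),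
    Finset.mem_univ _, ?_⟩
  · split_ifs
    · exact Finset.prod_nonneg fun e _ => (hα e).le
    · exact le_rfl
  · rw [if_pos]
    · exact Finset.prod_pos fun e _ => hα e
    · convert hT'
      have : (Subtype.val '' ((Finset.univ.filter (fun e : G.edgeSet => e.1 ∈ T.edgeSet) :
          Finset G.edgeSet) : Set G.edgeSet)) = T.edgeSet := by
        ext e
        simp only [Finset.coe_filter, Finset.mem_univ, true_and, Set.mem_image, Set.mem_ofPred_eq,
          Subtype.exists, exists_and_left, exists_prop, exists_eq_right_right]
        constructor
        · exact fun h => h.1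
        · exact fun h => ⟨h, SimpleGraph.edgeSet_mono hT h⟩
      rw [this, SimpleGraph.fromEdgeSet_edgeSet]

/-- extension by zero -/
noncomputable def ext0 {V : Type*} (u : V) (y : {i // i ≠ u} → HH) (i : V) : HH :=
  if h : i ≠ u then y ⟨i, h⟩ else 0

/-- difference along an edge -/
noncomputable def dE {V : Type*} (x : V → HH) (e : Sym2 V) : HH :=
  x (Quot.out e).1 - x (Quot.out e).2

lemma dE_eq {V : Type*} [Fintype V] (u : V) (y : {i // i ≠ u} → HH) (e : Sym2 V) :
    ∑ i : {i // i ≠ u}, (sg e i.1 : ℝ) • y i = dE (ext0 u y) e := by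
  have h1 : ∑ i : V, (sg e i : ℝ) • ext0 u y i = dE (ext0 u y) e := by
    simp [sg, sub_smul, Finset.sum_sub_distrib, dE]
  rw [← h1, ← Fintype.sum_subtype_add_sum_subtype (fun i => i ≠ u)]
  have h2 : ∑ i : {i // ¬ i ≠ u}, (sg e i.1 : ℝ) • ext0 u y i.1 = 0 := by
    refine Finset.sum_eq_zero fun i _ => ?_
    simp [ext0, not_not.1 i.2]
  rw [h2, add_zero]
  refine Finset.sum_congr rfl fun i _ => ?_
  simp only [ext0, dif_pos i.2]

lemma quad_gen {n E : Type*} [Fintype n] [Fintype E] {M : Type*} [NormedAddCommGroup M]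
    [InnerProductSpace ℝ M] (s : E → n → ℝ) (α : E → ℝ) (y : n → M) :
    ∑ i, ∑ j, (∑ e, s e i * α e * s e j) * inner ℝ (y i) (y j)
      = ∑ e, α e * ‖∑ i, s e i • y i‖ ^ 2 := by
  have h : ∀ e, α e * ‖∑ i, s e i • y i‖ ^ 2
      = ∑ i, ∑ j, (s e i * α e * s e j) * inner ℝ (y i) (y j) := by
    intro e
    rw [← real_inner_self_eq_norm_sq]
    simp only [sum_inner, inner_sum, Finset.mul_sum]
    refine Finset.sum_congr rfl fun i _ => Finset.sum_congr rfl fun j _ => ?_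
    rw [real_inner_smul_left, real_inner_smul_right, real_inner_comm]
    ring
  simp only [h, Finset.sum_mul]
  conv_rhs => rw [Finset.sum_comm]
  refine Finset.sum_congr rfl fun i _ => ?_
  conv_rhs => rw [Finset.sum_comm]

lemma gauss_graph {V : Type*} [Fintype V] (G : SimpleGraph V) (hG : G.Connected)
    [Fintype G.edgeSet] (u : V) (α : G.edgeSet → ℝ) (hα : ∀ e, 0 < α e) :
    ∫⁻ y : {i // i ≠ u} → HH, ENNReal.ofReal (Real.exp (-∑ e : G.edgeSet, α e * ‖dE (ext0 u y) e.1‖ ^ 2))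
      = ENNReal.ofReal ((phiT G α ^ 2)⁻¹) * gC ^ Fintype.card {i // i ≠ u} := by
  set A : Matrix {i // i ≠ u} {i // i ≠ u} ℝ :=
    Matrix.of fun i j => ∑ e : G.edgeSet, (sg e.1 i.1 : ℝ) * α e * (sg e.1 j.1 : ℝ) with hA
  have hdet : A.det = phiT G α := by
    rw [hA]; exact matrix_tree G u α
  have hpos := phi_pos G hG α hα
  have hpsd : A.PosSemidef := by
    refine Matrix.PosSemidef.of_dotProduct_mulVec_nonneg ?_ ?_
    · ext i j
      simp only [Matrix.conjTranspose_apply, hA, Matrix.of_apply, star_trivial]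
      exact Finset.sum_congr rfl fun e _ => by ring
    · intro x
      have h1 := quad_gen (fun (e : G.edgeSet) (i : {i // i ≠ u}) => (sg e.1 i.1 : ℝ)) α x
      have h2 : star x ⬝ᵥ A *ᵥ x = ∑ e, α e * ‖∑ i : {i // i ≠ u}, (sg e.1 i.1 : ℝ) • x i‖ ^ 2 := by
        rw [← h1]
        simp only [dotProduct, Matrix.mulVec, Finset.mul_sum, hA, Matrix.of_apply, star_trivial]
        refine Finset.sum_congr rfl fun i _ => Finset.sum_congr rfl fun j _ => ?_
        simp
        ring
      rw [h2]
      exact Finset.sum_nonneg fun e _ => mul_nonneg (hα e).le (by positivity)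
  have := gauss_integral A hpsd (by rw [hdet]; exact hpos.ne')
  rw [hdet] at this
  rw [← this]
  refine lintegral_congr fun y => ?_
  congr 3
  rw [hA]
  have h1 := quad_gen (fun (e : G.edgeSet) (i : {i // i ≠ u}) => (sg e.1 i.1 : ℝ)) α y
  simp only [Matrix.of_apply, h1, dE_eq]


lemma prod_split {E M : Type*} [Fintype E] [DecidableEq E] [CommMonoid M] (e₀ : E) (f : E → M) :
    ∏ e, f e = f e₀ * ∏ e : {e : E // e ≠ e₀}, f e.1 := by
  rw [← Finset.mul_prod_erase Finset.univ f (Finset.mem_univ e₀)]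
  congr 1
  rw [Finset.prod_subtype (p := fun e => e ≠ e₀)]
  simp

lemma sum_split {E M : Type*} [Fintype E] [DecidableEq E] [AddCommMonoid M] (e₀ : E) (f : E → M) :
    ∑ e, f e = f e₀ + ∑ e : {e : E // e ≠ e₀}, f e.1 := by
  rw [← Finset.add_sum_erase Finset.univ f (Finset.mem_univ e₀)]
  congr 1
  rw [Finset.sum_subtype (p := fun e => e ≠ e₀)]
  simp

/-- set the variable of the distinguished edge to one -/
noncomputable def xE {E : Type*} (e₀ : E) (x : {e : E // e ≠ e₀} → ℝ) (e : E) : ℝ :=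
  if h : e = e₀ then (1 : ℝ) else x ⟨e, h⟩

lemma xE_base {E : Type*} (e₀ : E) (x : {e : E // e ≠ e₀} → ℝ) : xE e₀ x e₀ = 1 := by simp [xE]

lemma xE_other {E : Type*} (e₀ : E) (x : {e : E // e ≠ e₀} → ℝ) (e : {e : E // e ≠ e₀}) :
    xE e₀ x e.1 = x e := by simp [xE, e.2]

lemma dE_meas {V : Type*} (u : V) (e : Sym2 V) :
    Measurable (fun y : {i // i ≠ u} → HH => dE (ext0 u y) e) := by
  have h : ∀ i, Measurable (fun y : {i // i ≠ u} → HH => ext0 u y i) := by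
    intro i
    unfold ext0
    split_ifs
    · fun_prop
    · fun_prop
  unfold dE
  exact (h _).sub (h _)

lemma param_pt {V : Type*} [Fintype V] (G : SimpleGraph V) (hG : G.Connected)
    [Fintype G.edgeSet] (e₀ : G.edgeSet) (u : V) (x : {e : G.edgeSet // e ≠ e₀} → ℝ)
    (hx : ∀ e, 0 < x e) :
    ENNReal.ofReal (1 / (psiT G (xE e₀ x)) ^ 2) * gC ^ Fintype.card {i // i ≠ u}
    = ∫⁻ y : {i // i ≠ u} → HH, ENNReal.ofReal (Real.exp (-‖dE (ext0 u y) e₀.1‖ ^ 2)) *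
      ∏ e : {e : G.edgeSet // e ≠ e₀},
        ENNReal.ofReal ((x e ^ 2)⁻¹ * Real.exp (-((x e)⁻¹ * ‖dE (ext0 u y) e.1.1‖ ^ 2))) := by
  have hX : ∀ e, 0 < xE e₀ x e := by
    intro e
    unfold xE
    split_ifs
    · exact one_pos
    · exact hx _
  have hprod : ∏ e, xE e₀ x e = ∏ e, x e := by
    rw [prod_split e₀, xE_base, one_mul]
    exact Finset.prod_congr rfl fun e _ => xE_other _ _ _
  have hg := gauss_graph G hG u (fun e => (xE e₀ x e)⁻¹) (fun e => inv_pos.2 (hX e))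
  have hp := phi_pos G hG (fun e => (xE e₀ x e)⁻¹) (fun e => inv_pos.2 (hX e))
  have hP : 0 < ∏ e, x e := Finset.prod_pos fun e _ => hx e
  rw [psi_phi G _ hX, hprod]
  have h1 : 1 / ((∏ e, x e) * phiT G (fun e => (xE e₀ x e)⁻¹)) ^ 2
      = (∏ e, (x e ^ 2)⁻¹) * (phiT G (fun e => (xE e₀ x e)⁻¹) ^ 2)⁻¹ := by
    rw [Finset.prod_inv_distrib, Finset.prod_pow]
    field_simp
  have hq : 0 ≤ ∏ e, (x e ^ 2)⁻¹ := Finset.prod_nonneg fun e _ => by positivity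
  rw [h1, ENNReal.ofReal_mul hq, mul_assoc, ← hg, ← lintegral_const_mul']
  · refine lintegral_congr fun y => ?_
    rw [← ENNReal.ofReal_mul hq, ← ENNReal.ofReal_prod_of_nonneg (fun e _ => by positivity),
      ← ENNReal.ofReal_mul (by positivity)]
    congr 1
    rw [Finset.prod_mul_distrib, ← Real.exp_sum, sum_split e₀, xE_base, mul_left_comm, ← Real.exp_add]
    congr 2
    simp only [xE_other, Finset.sum_neg_distrib]
    ring
  · exact ENNReal.ofReal_ne_top

lemma param_main {V : Type*} [Fintype V] (G : SimpleGraph V) (hG : G.Connected)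
    [Fintype G.edgeSet] (e₀ : G.edgeSet) (u : V) :
    (∫⁻ x in (Set.univ.pi fun _ : {e : G.edgeSet // e ≠ e₀} => Set.Ioi (0 : ℝ)),
      ENNReal.ofReal (1 / (psiT G (xE e₀ x)) ^ 2)) * gC ^ Fintype.card {i // i ≠ u}
    = ∫⁻ y : {i // i ≠ u} → HH, ENNReal.ofReal (Real.exp (-‖dE (ext0 u y) e₀.1‖ ^ 2)) *
      ∏ e : {e : G.edgeSet // e ≠ e₀}, (ENNReal.ofReal (‖dE (ext0 u y) e.1.1‖ ^ 2))⁻¹ := by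
  have hms : MeasurableSet (Set.univ.pi fun _ : {e : G.edgeSet // e ≠ e₀} => Set.Ioi (0 : ℝ)) :=
    MeasurableSet.univ_pi fun _ => measurableSet_Ioi
  have hd : ∀ e : Sym2 V, Measurable (fun y : {i // i ≠ u} → HH => dE (ext0 u y) e) := dE_meas u
  rw [← lintegral_mul_const' _ _ (ENNReal.pow_ne_top gC_ne_top),
    setLIntegral_congr_fun hms (fun x hx => param_pt G hG e₀ u x (fun e => hx e (Set.mem_univ _))),
    lintegral_lintegral_swap]
  · refine lintegral_congr fun y => ?_
    rw [lintegral_const_mul' _ _ ENNReal.ofReal_ne_top]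
    congr 1
    rw [volume_pi, Measure.restrict_pi_pi]
    have := lintegral_pi_prod ((volume : Measure ℝ).restrict (Set.Ioi 0))
      (fun (e : {e : G.edgeSet // e ≠ e₀}) x =>
        ENNReal.ofReal ((x ^ 2)⁻¹ * Real.exp (-(x⁻¹ * ‖dE (ext0 u y) e.1.1‖ ^ 2))))
      (fun e => by fun_prop)
    rw [this]
    exact Finset.prod_congr rfl fun e _ => sch _ (by positivity)
  · apply Measurable.aemeasurable
    unfold Function.uncurry
    refine Measurable.mul ?_ (Finset.measurable_prod _ fun e _ => ?_)
    · have := (hd e₀.1).comp (measurable_snd : Measurable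
        (Prod.snd : ({e : G.edgeSet // e ≠ e₀} → ℝ) × ({i // i ≠ u} → HH) → _))
      have h2 : Measurable fun z : HH => ENNReal.ofReal (Real.exp (-‖z‖ ^ 2)) := by fun_prop
      exact h2.comp this
    · have h1 := (hd e.1.1).comp (measurable_snd : Measurable
        (Prod.snd : ({e : G.edgeSet // e ≠ e₀} → ℝ) × ({i // i ≠ u} → HH) → _))
      have h2 : Measurable fun z : ℝ × HH =>
        ENNReal.ofReal ((z.1 ^ 2)⁻¹ * Real.exp (-(z.1⁻¹ * ‖z.2‖ ^ 2))) := by fun_prop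
      have h3 : Measurable fun p : ({e : G.edgeSet // e ≠ e₀} → ℝ) × ({i // i ≠ u} → HH) => p.1 e :=
        (measurable_pi_apply e).comp measurable_fst
      exact h2.comp (h3.prodMk h1)

lemma graphPeriod_eq {V : Type*} [Fintype V] (G : SimpleGraph V)
    [inst : Fintype G.edgeSet] (e₀ : G.edgeSet) :
    graphPeriod G e₀ = (∫⁻ x in (Set.univ.pi fun _ : {e : G.edgeSet // e ≠ e₀} => Set.Ioi (0 : ℝ)),
      ENNReal.ofReal (1 / (psiT G (xE e₀ x)) ^ 2)).toReal := by
  obtain rfl : inst = Fintype.ofFinite _ := Subsingleton.elim _ _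
  unfold graphPeriod
  have h : ∀ x : {e : G.edgeSet // e ≠ e₀} → ℝ, MvPolynomial.aeval (fun e : G.edgeSet =>
      if h : e = e₀ then (1 : ℝ) else x ⟨e, h⟩) (graphPoly G) = psiT G (xE e₀ x) := by
    intro x
    unfold graphPoly psiT xE
    rw [map_sum]
    refine Finset.sum_congr (by ext; simp) fun T _ => ?_
    split_ifs
    · simp only [map_prod, MvPolynomial.aeval_X]
      exact Finset.prod_congr (by ext; simp) fun _ _ => by congr!
    · simp
  simp only [h]
  rw [integral_eq_lintegral_of_nonneg_ae ?_ ?_]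
  · congr!
  · exact Filter.Eventually.of_forall fun x => by positivity
  · apply Measurable.aestronglyMeasurable
    have hx : ∀ e, Measurable (fun x => xE e₀ x e) := by
      intro e
      unfold xE
      split_ifs
      · fun_prop
      · fun_prop
    have : Measurable (fun x => psiT G (xE e₀ x)) := by
      unfold psiT
      refine Finset.measurable_sum _ fun T _ => ?_
      split_ifs
      · exact Finset.measurable_prod _ fun e _ => hx e
      · fun_prop
    fun_prop


lemma LM_image {V W : Type*} (φ : V → W) (hφ : Function.Injective φ) (s : Finset V)
    (F : (V → HH) → ℝ≥0∞) (hF : Measurable F) (x : W → HH) :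
    LM (s.image φ) (fun z => F (fun i => z (φ i))) x = LM s F (fun i => x (φ i)) := by
  exact lmarginal_image (X := fun _ => HH) (μ := fun _ => volume) hφ s hF x

lemma lintegral_LM {V : Type*} [Fintype V] (F : (V → HH) → ℝ≥0∞) (x : V → HH) :
    ∫⁻ y, F y = LM Finset.univ F x := by
  unfold LM
  rw [volume_pi, lintegral_eq_lmarginal_univ x]

lemma prod_adj_edges {V M : Type*} [Fintype V] [CommMonoid M] (G : SimpleGraph V)
    [Fintype G.edgeSet] (h : V → V → M) (g : Sym2 V → M)
    (hg : ∀ i j, h i j * h j i = g s(i, j)) :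
    (∏ i, ∏ j, if G.Adj i j then h i j else 1) = ∏ e : G.edgeSet, g e.1 := by
  have h1 : ∏ e : G.edgeSet, g e.1 = ∏ e : Sym2 V, if e ∈ G.edgeSet then g e else 1 := by
    rw [← Finset.prod_filter]
    rw [Finset.prod_subtype (p := fun e => e ∈ G.edgeSet) _ (by simp)]
  rw [h1, ← Finset.prod_product', Finset.univ_product_univ,
    ← Finset.prod_fiberwise Finset.univ (fun p : V × V => s(p.1, p.2))]
  refine Finset.prod_congr rfl fun e _ => ?_
  induction e using Sym2.ind with
  | _ a b =>
  by_cases hab : G.Adj a b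
  · have : (Finset.univ.filter fun p : V × V => s(p.1, p.2) = s(a, b)) = {(a, b), (b, a)} := by
      ext ⟨p, q⟩
      simp [Prod.ext_iff]
    rw [this, Finset.prod_pair (by simp [Prod.ext_iff]; intro h; exact absurd h hab.ne)]
    simp [hab, hab.symm, hg]
  · rw [if_neg (by simpa using hab)]
    refine Finset.prod_eq_one fun p hp => ?_
    have hp' : s(p.1, p.2) = s(a, b) := by simpa using hp
    rw [if_neg]
    rw [← SimpleGraph.mem_edgeSet, hp']
    simpa using hab

lemma norm_dE {V : Type*} (x : V → HH) (a b : V) : ‖dE x s(a, b)‖ = ‖x a - x b‖ := by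
  unfold dE
  have h := sym2_out s(a, b)
  rw [Sym2.eq_iff] at h
  rcases h with ⟨h1, h2⟩ | ⟨h1, h2⟩
  · rw [h1, h2]
  · rw [h1, h2, norm_sub_rev]

lemma FG_edges {W : Type*} [Fintype W] (Γ : SimpleGraph W) (v : W) (z : W → HH)
    [Fintype (delVert Γ v).edgeSet] :
    FG Γ v z = ∏ e : (delVert Γ v).edgeSet,
      (ENNReal.ofReal (‖dE (fun i => z i.1) e.1‖ ^ 2))⁻¹ := by
  have hsub : ∀ f : W → ℝ≥0∞, f v = 1 → ∏ i, f i = ∏ i : ↥{u : W | u ≠ v}, f i.1 := by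
    intro f hf
    rw [← Finset.prod_subtype (Finset.univ.filter (· ≠ v)) (by simp), Finset.prod_filter]
    refine Finset.prod_congr rfl fun i _ => ?_
    split_ifs with h
    · rfl
    · rw [not_not.1 h, hf]
  rw [← prod_adj_edges (delVert Γ v) (fun i j => ‖z i.1 - z j.1‖ₑ⁻¹)
    (fun e => (ENNReal.ofReal (‖dE (fun i => z i.1) e‖ ^ 2))⁻¹)]
  · unfold FG
    rw [hsub _ (by simp)]
    refine Finset.prod_congr rfl fun i _ => ?_
    rw [hsub _ (by simp)]
    refine Finset.prod_congr rfl fun j _ => ?_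
    have hi : i.1 ≠ v := i.2
    have hj : j.1 ≠ v := j.2
    simp [delVert, hi, hj]
  · intro i j
    rw [norm_dE, enorm_sub_rev (z j.1), ← sq, ENNReal.ofReal_pow (norm_nonneg _), ofReal_norm,
      ENNReal.inv_pow]

lemma posInt_scale {W : Type*} [Fintype W] (Γ : SimpleGraph W)
    (hreg : ∀ w : W, Nat.card (Γ.neighborSet w) = 4) (v u w : W)
    (hvu : v ≠ u) (hvw : v ≠ w) (huw : u ≠ w) (q : HH) (hq : q ≠ 0) :
    LM (Finset.univ \ {v, u, w}) (FG Γ v) (Function.update 0 w q)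
      = (‖q‖ₑ⁻¹) ^ 4 * posInt Γ v u w := by
  set s := (Finset.univ \ {v, u, w} : Finset W) with hs
  have hcard : s.card + 3 = Fintype.card W := by
    have h4 : ({v, u, w} : Finset W).card = 3 := by
      rw [Finset.card_insert_of_notMem, Finset.card_insert_of_notMem,
        Finset.card_singleton] <;> simp [*]
    rw [hs, Finset.card_sdiff_of_subset (Finset.subset_univ _), h4, Finset.card_univ]
    have := Finset.card_le_univ ({v, u, w} : Finset W)
    omega
  have hx : (Function.update 0 w q : W → HH) =
      fun i => (Pi.single w 1 : W → HH) i * q := by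
    ext1 i
    by_cases h : i = w
    · subst h; simp
    · simp [h]
  rw [hx, LM_change (fun y => y * q) (by fun_prop) (fun y => ‖q‖ₑ ^ 4) (by fun_prop)
    (fun f hf => lintegral_HH_mul q hq f hf) _ (FG_measurable Γ v)]
  simp_rw [FG_mul Γ hreg v _ q hq, Finset.prod_const, ← mul_assoc]
  rw [LM_mul_left s (fun _ => (‖q‖ₑ ^ 4) ^ s.card * ‖q‖ₑ⁻¹ ^ (4 * Fintype.card W - 8)) _
    (FG_measurable Γ v) (fun _ _ _ => rfl)]
  unfold posInt
  rw [← hs]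
  congr 1
  have : 4 * Fintype.card W - 8 = 4 * s.card + 4 := by omega
  rw [this, pow_add, ← mul_assoc, ← pow_mul, ← mul_pow,
    ENNReal.mul_inv_cancel (by simp [hq]) (by simp), one_pow, one_mul]

lemma natcard_ne {α : Type*} [Finite α] (a : α) : Nat.card {i // i ≠ a} = Nat.card α - 1 := by
  have : Fintype α := Fintype.ofFinite α
  rw [Nat.card_eq_fintype_card, Nat.card_eq_fintype_card]
  simp [Fintype.card_subtype, Finset.filter_ne', Finset.card_erase_of_mem]

/-- gaussian weight -/
noncomputable def KG (c : HH) : ℝ≥0∞ := ENNReal.ofReal (Real.exp (-‖c‖ ^ 2)) *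
      ENNReal.ofReal (‖c‖ ^ 2)

lemma param_LM {V W : Type*} [Fintype V] (G : SimpleGraph V) (hG : G.Connected)
    [Fintype G.edgeSet] (e₀ : G.edgeSet) (u w : V) (he : e₀.1 = s(u, w)) (φ : V → W)
    (hφ : Function.Injective φ) (s : Finset W) (hs : ∀ i, i ∈ s ↔ ∃ j, j ≠ u ∧ φ j = i) :
    graphPeriod G e₀ = (LM s (fun z => KG (z (φ w)) * ∏ e : G.edgeSet,
      (ENNReal.ofReal (‖dE (fun i => z (φ i)) e.1‖ ^ 2))⁻¹) 0 / gC ^ (Nat.card V - 1)).toReal := by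
  rw [graphPeriod_eq]
  congr 1
  have hpm := param_main G hG e₀ u
  have hc := natcard_ne u
  rw [Nat.card_eq_fintype_card] at hc
  rw [hc] at hpm
  have hg0 := gC_ne_zero
  have hg1 := gC_ne_top
  rw [ENNReal.eq_div_iff (pow_ne_zero _ hg0) (ENNReal.pow_ne_top hg1), mul_comm, hpm]
  clear hpm
  have huw : u ≠ w := by
    have hadj : G.Adj u w := by
      rw [← SimpleGraph.mem_edgeSet, ← he]; exact e₀.2
    exact hadj.ne
  set f : ({i // i ≠ u} → HH) → ℝ≥0∞ := fun y =>
      ENNReal.ofReal (Real.exp (-‖dE (ext0 u y) e₀.1‖ ^ 2)) *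
      ∏ e' : {e' : G.edgeSet // e' ≠ e₀},
        (ENNReal.ofReal (‖dE (ext0 u y) e'.1.1‖ ^ 2))⁻¹ with hf
  have hfm : Measurable f := by
    refine Measurable.mul ?_ (Finset.measurable_prod _ fun e' _ => ?_)
    · have := dE_meas u e₀.1
      fun_prop
    · have := dE_meas u e'.1.1
      fun_prop
  have h1 := LM_image (fun i : {i : V // i ≠ u} => φ i.1)
      (fun i j h => Subtype.ext (hφ h)) Finset.univ f hfm (0 : W → HH)
  have h2 : (Finset.univ : Finset {i : V // i ≠ u}).image (fun i => φ i.1) = s := by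
    ext i
    simp [hs]
  rw [h2] at h1
  rw [lintegral_LM f (fun _ => 0)]
  refine h1.symm.trans (LM_congr_ae _ _ _ _ fun z hz hz' => ?_)
  have hzw : z (φ w) ≠ 0 := hz' _ ((hs _).2 ⟨w, huw.symm, rfl⟩)
  have hzu : z (φ u) = 0 := hz _ (by
    rw [hs]; rintro ⟨j, hj, hj'⟩; exact hj (hφ hj'))
  have hext : ext0 u (fun i : {i : V // i ≠ u} => z (φ i.1)) = fun i => z (φ i) := by
    ext1 i
    unfold ext0
    split_ifs with h
    · rfl
    · rw [not_not.1 h, hzu]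
  have hnorm : ‖dE (fun i => z (φ i)) e₀.1‖ = ‖z (φ w)‖ := by
    rw [he, norm_dE, hzu, zero_sub, norm_neg]
  simp only [hf, hext, KG]
  rw [prod_split e₀ (fun e : G.edgeSet =>
    (ENNReal.ofReal (‖dE (fun i => z (φ i)) e.1‖ ^ 2))⁻¹), hnorm]
  rw [← mul_assoc, mul_assoc (ENNReal.ofReal (Real.exp _)), ENNReal.mul_inv_cancel, mul_one]
  · simp [hzw]
  · simp

lemma graphPeriod_posInt {W : Type*} [Fintype W] (Γ : SimpleGraph W)
    (hreg : ∀ w : W, Nat.card (Γ.neighborSet w) = 4) (v : W) (hcon : (delVert Γ v).Connected)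
    (e : (delVert Γ v).edgeSet) (u w : ↥{u : W | u ≠ v}) (he : e.1 = s(u, w)) :
    graphPeriod (delVert Γ v) e = (posInt Γ v u.1 w.1 / gC ^ (Fintype.card W - 3)).toReal := by
  have : Fintype (delVert Γ v).edgeSet := Fintype.ofFinite _
  have hvu : v ≠ u.1 := fun h => u.2 h.symm
  have hvw : v ≠ w.1 := fun h => w.2 h.symm
  have hadj : (delVert Γ v).Adj u w := by
    rw [← SimpleGraph.mem_edgeSet, ← he]; exact e.2
  have huw : u.1 ≠ w.1 := fun h => hadj.ne (Subtype.ext h)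
  have hn : 3 ≤ Fintype.card W := by
    have h4 : ({v, u.1, w.1} : Finset W).card = 3 := by
      rw [Finset.card_insert_of_notMem, Finset.card_insert_of_notMem,
        Finset.card_singleton] <;> simp [*]
    rw [← h4]; exact Finset.card_le_univ _
  have hg0 := gC_ne_zero
  have hg1 := gC_ne_top
  rw [param_LM (delVert Γ v) hcon e u w he Subtype.val Subtype.val_injective
    (insert w.1 (Finset.univ \ {v, u.1, w.1}))]
  · have h2 : Nat.card ↥{u : W | u ≠ v} - 1 = (Fintype.card W - 3) + 1 := by
      have h2 : Nat.card ↥{u : W | u ≠ v} = Nat.card W - 1 := natcard_ne v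
      rw [Nat.card_eq_fintype_card (α := W)] at h2
      omega
    rw [h2, pow_succ]
    simp_rw [← FG_edges]
    have hKm : Measurable KG := by unfold KG; fun_prop
    rw [LM_insert _ (fun z => KG (z w.1) * FG Γ v z) ((hKm.comp (measurable_pi_apply _)).mul (FG_measurable Γ v)) _ (by simp)]
    have h4 : ∀ c : HH, c ≠ 0 → LM (Finset.univ \ {v, u.1, w.1}) (fun z => KG (z w.1) * FG Γ v z)
        (Function.update 0 w.1 c) = posInt Γ v u.1 w.1 * ((ENNReal.ofReal (‖c‖ ^ 2))⁻¹ *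
          ENNReal.ofReal (Real.exp (-‖c‖ ^ 2))) := by
      intro c hc
      rw [LM_mul_left _ (fun z => KG (z w.1)) _ (FG_measurable Γ v)
        (fun x y h => by simp only [h w.1 (by simp)]), posInt_scale Γ hreg v u w hvu hvw huw c hc]
      simp only [Function.update_self, KG]
      rw [ENNReal.ofReal_pow (norm_nonneg _), ofReal_norm, ENNReal.inv_pow]
      have h5 : ‖c‖ₑ * ‖c‖ₑ⁻¹ = 1 := ENNReal.mul_inv_cancel (by simp [hc]) (by simp)
      calc _ = posInt Γ v u.1 w.1 * (‖c‖ₑ⁻¹ ^ 2 * ENNReal.ofReal (Real.exp (-‖c‖ ^ 2))) *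
          (‖c‖ₑ * ‖c‖ₑ⁻¹) ^ 2 := by ring
        _ = _ := by rw [h5]; simp
    have h6 : ∀ᵐ q : HH, q ≠ 0 := by simp [ae_iff]
    rw [lintegral_congr_ae (g := fun c => posInt Γ v u.1 w.1 * ((ENNReal.ofReal (‖c‖ ^ 2))⁻¹ *
          ENNReal.ofReal (Real.exp (-‖c‖ ^ 2)))) (by filter_upwards [h6] with c hc using h4 c hc)]
    rw [lintegral_const_mul _ (by fun_prop), gK]
    rw [ENNReal.mul_div_mul_right _ _ hg0 hg1]
  · intro i
    simp only [Finset.mem_univ, true_and, Finset.mem_insert, Finset.mem_sdiff,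
        Finset.mem_singleton, not_or]
    constructor
    · rintro (h | ⟨h, h', h''⟩)
      · exact ⟨w, fun h => huw (by rw [h]), h.symm⟩
      · exact ⟨⟨i, h⟩, fun h3 => h' (congrArg Subtype.val h3), rfl⟩
    · rintro ⟨j, hj, rfl⟩
      by_cases h : j.1 = w.1
      · exact Or.inl h
      · exact Or.inr ⟨j.2, fun h => hj (Subtype.ext h), h⟩


/-- number of adjacent pairs between two vertex sets -/
noncomputable def cutN {W : Type*} (Γ : SimpleGraph W) (X Y : Finset W) : ℕ :=
  ∑ i ∈ X, ∑ j ∈ Y, if Γ.Adj i j then 1 else 0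

/-- number of neighbours in a set -/
noncomputable def dN {W : Type*} (Γ : SimpleGraph W) (i : W) (Y : Finset W) : ℕ :=
  ∑ j ∈ Y, if Γ.Adj i j then 1 else 0

lemma cutN_eq {W : Type*} (Γ : SimpleGraph W) (X Y : Finset W) :
    cutN Γ X Y = ∑ i ∈ X, dN Γ i Y := rfl

lemma cutN_comm {W : Type*} (Γ : SimpleGraph W) (X Y : Finset W) :
    cutN Γ X Y = cutN Γ Y X := by
  unfold cutN
  rw [Finset.sum_comm]
  simp_rw [Γ.adj_comm]

lemma cutN_union {W : Type*} (Γ : SimpleGraph W) (X Y Z : Finset W) (h : Disjoint X Y) :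
    cutN Γ (X ∪ Y) Z = cutN Γ X Z + cutN Γ Y Z := by
  rw [cutN_eq, Finset.sum_union h]; rfl

lemma dN_union {W : Type*} (Γ : SimpleGraph W) (i : W) (X Y : Finset W) (h : Disjoint X Y) :
    dN Γ i (X ∪ Y) = dN Γ i X + dN Γ i Y := by
  unfold dN
  rw [Finset.sum_union h]

lemma dN_zero {W : Type*} (Γ : SimpleGraph W) (i : W) (X : Finset W) (h : ∀ j ∈ X, ¬ Γ.Adj i j) :
    dN Γ i X = 0 :=
  Finset.sum_eq_zero fun j hj => if_neg (h j hj)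

lemma dN_zero_iff {W : Type*} (Γ : SimpleGraph W) (i : W) (X : Finset W) :
    dN Γ i X = 0 ↔ ∀ j ∈ X, ¬ Γ.Adj i j := by
  simp [dN]

lemma dN_le {W : Type*} (Γ : SimpleGraph W) (i : W) (X : Finset W) : dN Γ i X ≤ X.card := by
  unfold dN
  rw [Finset.sum_boole]
  exact_mod_cast Finset.card_filter_le _ _

lemma dN_mono {W : Type*} (Γ : SimpleGraph W) (i : W) (X Y : Finset W) (h : X ⊆ Y) :
    dN Γ i X ≤ dN Γ i Y := Finset.sum_le_sum_of_subset h

lemma dN_univ {W : Type*} [Fintype W] (Γ : SimpleGraph W) (i : W) :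
    Nat.card (Γ.neighborSet i) = dN Γ i Finset.univ := by
  unfold dN
  rw [Finset.sum_boole, Nat.card_eq_fintype_card, Fintype.card_subtype]
  simp

lemma cutN_self_even {W : Type*} (Γ : SimpleGraph W) (X : Finset W) : Even (cutN Γ X X) := by
  induction X using Finset.induction_on with
  | empty => simp [cutN]
  | insert a X ha ih =>
    have h : ∀ i, dN Γ i (insert a X) = (if Γ.Adj i a then 1 else 0) + dN Γ i X := by
      intro i; unfold dN; rw [Finset.sum_insert ha]
    have h1 : cutN Γ (insert a X) (insert a X) = cutN Γ X X + (dN Γ a X + dN Γ a X) := by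
      rw [cutN_eq, Finset.sum_insert ha]
      simp_rw [h]
      rw [Finset.sum_add_distrib, if_neg (Γ.loopless.irrefl a), zero_add, ← cutN_eq]
      have : (∑ i ∈ X, if Γ.Adj i a then 1 else 0) = dN Γ a X := by
        unfold dN; simp_rw [Γ.adj_comm a]
      rw [this]; ring
    rw [h1]
    exact ih.add (Even.add_self _)

lemma cutN_even {W : Type*} [Fintype W] (Γ : SimpleGraph W)
    (hreg : ∀ i, dN Γ i Finset.univ = 4) (X : Finset W) : Even (cutN Γ X Xᶜ) := by
  have h1 : cutN Γ X X + cutN Γ X Xᶜ = 4 * X.card := by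
    rw [cutN_eq, cutN_eq, ← Finset.sum_add_distrib]
    simp_rw [← dN_union Γ _ X Xᶜ disjoint_compl_right]
    simp [Finset.union_compl, hreg, mul_comm]
  have h2 := cutN_self_even Γ X
  have h3 : Even (cutN Γ X X + cutN Γ X Xᶜ) := by rw [h1]; exact ⟨2 * X.card, by ring⟩
  exact (Nat.even_add.1 h3).1 h2

lemma conn_cut {W : Type*} [Fintype W] (Γ : SimpleGraph W) (h : Γ.Connected) (X : Finset W)
    (h1 : X.Nonempty) (h2 : Xᶜ.Nonempty) : ∃ i ∈ X, ∃ j ∈ Xᶜ, Γ.Adj i j := by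
  obtain ⟨i, hi⟩ := h1
  obtain ⟨j, hj⟩ := h2
  obtain ⟨p⟩ := h.preconnected i j
  obtain ⟨d, -, hd1, hd2⟩ := p.exists_boundary_dart (X : Set W) hi (by simpa using hj)
  exact ⟨d.fst, hd1, d.snd, by simpa using hd2, d.adj⟩

lemma not_conn_cut {W : Type*} [Fintype W] [Nonempty W] (Γ : SimpleGraph W) (h : ¬ Γ.Connected) :
    ∃ X : Finset W, X.Nonempty ∧ Xᶜ.Nonempty ∧ ∀ i ∈ X, ∀ j ∈ Xᶜ, ¬ Γ.Adj i j := by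
  rw [SimpleGraph.connected_iff_exists_forall_reachable] at h
  push Not at h
  obtain ⟨v⟩ := ‹Nonempty W›
  obtain ⟨w, hw⟩ := h v
  refine ⟨Finset.univ.filter (fun i => Γ.Reachable v i), ⟨v, by simp⟩, ⟨w, by simpa using hw⟩, ?_⟩
  intro i hi j hj hij
  simp only [Finset.mem_filter, Finset.mem_univ, true_and, Finset.mem_compl] at hi hj
  exact hj (hi.trans hij.reachable)

/-- the cut criterion -/
def CutCrit {W : Type*} [Fintype W] (Γ : SimpleGraph W) : Prop :=
  (∀ i, dN Γ i Finset.univ = 4) ∧ 5 ≤ Fintype.card W ∧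
    ∀ X : Finset W, 2 ≤ X.card → 2 ≤ Xᶜ.card → 5 ≤ cutN Γ X Xᶜ

lemma cutN_le_of_edges {W : Type*} [Fintype W] (Γ : SimpleGraph W) (X : Finset W)
    (C : Finset (Sym2 W)) (h : ∀ i ∈ X, ∀ j ∈ Xᶜ, Γ.Adj i j → s(i, j) ∈ C) :
    cutN Γ X Xᶜ ≤ C.card := by
  unfold cutN
  rw [← Finset.sum_product', Finset.sum_boole]
  simp only [Nat.cast_id]
  refine Finset.card_le_card_of_injOn (fun p => s(p.1, p.2)) ?_ ?_
  · rintro ⟨i, j⟩ hp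
    simp only [Finset.coe_filter, Finset.mem_product, Set.mem_ofPred_eq] at hp
    exact h i hp.1.1 j hp.1.2 hp.2
  · rintro ⟨i, j⟩ hp ⟨i', j'⟩ hp' hh
    simp only [Finset.coe_filter, Finset.mem_product, Set.mem_ofPred_eq, Finset.mem_compl] at hp hp'
    simp only [Sym2.eq_iff] at hh
    rcases hh with ⟨rfl, rfl⟩ | ⟨rfl, rfl⟩
    · rfl
    · exact absurd hp.1.1 hp'.1.2

lemma cp_of_crit {W : Type*} [Fintype W] (Γ : SimpleGraph W) (h : CutCrit Γ) :
    IsCompletedPrimitive Γ := by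
  obtain ⟨hreg, h5, hcut⟩ := h
  have hne : Nonempty W := Fintype.card_pos_iff.1 (by omega)
  have hbig : ∀ X : Finset W, X.Nonempty → (∀ i ∈ X, ∀ j ∈ Xᶜ, ¬ Γ.Adj i j) → 2 ≤ X.card := by
    intro X ⟨i, hi⟩ hX
    have h1 := dN_union Γ i X Xᶜ disjoint_compl_right
    rw [Finset.union_compl, hreg, dN_zero Γ i Xᶜ (hX i hi)] at h1
    have := dN_le Γ i X
    omega
  refine ⟨?_, fun w => by rw [dN_univ, hreg], h5, fun C hC hC4 => ?_⟩
  · by_contra hcon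
    obtain ⟨X, h1, h2, h3⟩ := not_conn_cut Γ hcon
    have h4 := hcut X (hbig X h1 h3) (hbig Xᶜ h2 (by
      intro i hi j hj hij
      rw [compl_compl] at hj
      exact h3 j hj i hi hij.symm))
    rw [cutN_eq, Finset.sum_eq_zero (fun i hi => dN_zero Γ i _ (h3 i hi))] at h4
    omega
  · by_contra hcon
    push Not at hcon
    obtain ⟨hcon, hiso⟩ := hcon
    obtain ⟨X, h1, h2, h3⟩ := not_conn_cut _ hcon
    have hX1 : 2 ≤ X.card := by
      by_contra hlt
      have : X.card = 1 := by have := h1.card_pos; omega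
      obtain ⟨w, rfl⟩ := Finset.card_eq_one.1 this
      obtain ⟨u, hu⟩ := hiso w
      exact h3 w (by simp) u (by simpa using hu.ne') hu
    have hX2 : 2 ≤ Xᶜ.card := by
      by_contra hlt
      have : Xᶜ.card = 1 := by have := h2.card_pos; omega
      obtain ⟨w, hw⟩ := Finset.card_eq_one.1 this
      obtain ⟨u, hu⟩ := hiso w
      refine h3 u ?_ w (by simp [hw]) hu.symm
      have : u ∉ Xᶜ := by rw [hw]; simpa using hu.ne'
      simpa using this
    have := hcut X hX1 hX2
    have hfin : Fintype C := Fintype.ofFinite _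
    have h4 := cutN_le_of_edges Γ X C.toFinset (fun i hi j hj hij => by
      have := h3 i hi j hj
      rw [SimpleGraph.deleteEdges_adj] at this
      rw [Set.mem_toFinset]
      by_contra hh
      exact this ⟨hij, hh⟩)
    rw [Set.toFinset_card, ← Nat.card_eq_fintype_card, hC4] at h4
    omega

lemma cut_star {W : Type*} [Fintype W] (Γ : SimpleGraph W) (h : IsCompletedPrimitive Γ)
    (X : Finset W) (h1 : X.Nonempty) (h2 : Xᶜ.Nonempty) (C0 : Finset (Sym2 W))
    (hC0 : ∀ e ∈ C0, e ∈ Γ.edgeSet) (hcard : C0.card ≤ 4)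
    (hX : ∀ i ∈ X, ∀ j ∈ Xᶜ, Γ.Adj i j → s(i, j) ∈ C0) :
    ∃ w, ∀ e ∈ C0, w ∈ e := by
  obtain ⟨hcon, hreg, h5, hC⟩ := h
  have hreg' : ∀ i, dN Γ i Finset.univ = 4 := fun i => by rw [← dN_univ, hreg]
  have hstar : ∀ w, ((Finset.univ.filter (fun j => Γ.Adj w j)).image (fun j => s(w, j))).card = 4 := by
    intro w
    rw [Finset.card_image_of_injective]
    · have := hreg' w
      unfold dN at this
      rw [Finset.sum_boole] at this
      exact_mod_cast this
    · intro i j hij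
      exact Sym2.congr_right.1 hij
  obtain ⟨C, hC1, hC2, hC4⟩ := Finset.exists_subsuperset_card_eq
    (s := C0) (t := Finset.univ.filter (· ∈ Γ.edgeSet)) (n := 4) (fun e he => by simpa using hC0 e he)
    hcard (by
      obtain ⟨w, -⟩ := h1
      rw [← hstar w]
      refine Finset.card_le_card fun e he => ?_
      simp only [Finset.mem_image, Finset.mem_filter, Finset.mem_univ, true_and] at he
      obtain ⟨j, hj, rfl⟩ := he
      simpa using hj)
  rcases hC (C : Set (Sym2 W)) (fun e he => by simpa using hC2 he) (by simpa using hC4) with hh | ⟨w, hw⟩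
  · obtain ⟨i, hi, j, hj, hij⟩ := conn_cut _ hh X h1 h2
    rw [SimpleGraph.deleteEdges_adj] at hij
    exact absurd (hC1 (hX i hi j hj hij.1)) hij.2
  · refine ⟨w, fun e he => ?_⟩
    have hsub : (Finset.univ.filter (fun j => Γ.Adj w j)).image (fun j => s(w, j)) ⊆ C := by
      intro f hf
      simp only [Finset.mem_image, Finset.mem_filter, Finset.mem_univ, true_and] at hf
      obtain ⟨j, hj, rfl⟩ := hf
      have := hw j
      rw [SimpleGraph.deleteEdges_adj] at this
      by_contra hh
      exact this ⟨hj, hh⟩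
    have heq := Finset.eq_of_subset_of_card_le hsub (by rw [hstar, hC4])
    have := hC1 he
    rw [← heq] at this
    simp only [Finset.mem_image, Finset.mem_filter, Finset.mem_univ, true_and] at this
    obtain ⟨j, -, rfl⟩ := this
    simp

/-- cut edges -/
noncomputable def cutE {W : Type*} [Fintype W] (Γ : SimpleGraph W) (X : Finset W) :
    Finset (Sym2 W) := ((X ×ˢ Xᶜ).filter (fun p => Γ.Adj p.1 p.2)).image (fun p => s(p.1, p.2))

lemma cutE_card {W : Type*} [Fintype W] (Γ : SimpleGraph W) (X : Finset W) :
    (cutE Γ X).card ≤ cutN Γ X Xᶜ := by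
  unfold cutE cutN
  rw [← Finset.sum_product', Finset.sum_boole]
  exact Finset.card_image_le

lemma mem_cutE {W : Type*} [Fintype W] (Γ : SimpleGraph W) (X : Finset W) (i j : W) (hi : i ∈ X)
    (hj : j ∈ Xᶜ) (hij : Γ.Adj i j) : s(i, j) ∈ cutE Γ X := by
  unfold cutE
  rw [Finset.mem_image]
  exact ⟨(i, j), by simp [hi, hij]; simpa using hj, rfl⟩

lemma cutE_edge {W : Type*} [Fintype W] (Γ : SimpleGraph W) (X : Finset W) (e) (he : e ∈ cutE Γ X) :
    e ∈ Γ.edgeSet := by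
  unfold cutE at he
  rw [Finset.mem_image] at he
  obtain ⟨p, hp, rfl⟩ := he
  rw [Finset.mem_filter] at hp
  exact hp.2

lemma edge_avoid {W : Type*} [Fintype W] (Γ : SimpleGraph W) (hreg : ∀ i, dN Γ i Finset.univ = 4)
    (h5 : 5 ≤ Fintype.card W) (w : W) : ∃ e ∈ Γ.edgeSet, w ∉ e := by
  have : Nontrivial W := Fintype.one_lt_card_iff_nontrivial.1 (by omega)
  obtain ⟨x, hx⟩ := exists_ne w
  by_contra hcon
  push Not at hcon
  have h1 := dN_union Γ x {w} {w}ᶜ disjoint_compl_right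
  rw [Finset.union_compl, hreg, dN_zero Γ x {w}ᶜ] at h1
  · have := dN_le Γ x {w}
    simp at this
    omega
  · intro j hj hxj
    have := hcon s(x, j) hxj
    simp at this hj
    rcases this with h | h
    · exact hx h.symm
    · exact hj h.symm

lemma crit_aux {W : Type*} [Fintype W] (Γ : SimpleGraph W) (h : IsCompletedPrimitive Γ)
    (X : Finset W) (h1 : 2 ≤ X.card) (h2 : Xᶜ.Nonempty) (w : W) (hwX : w ∈ X)
    (hcut : cutN Γ X Xᶜ = 4) (hw : ∀ e ∈ cutE Γ X, w ∈ e) : False := by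
  have hreg' : ∀ i, dN Γ i Finset.univ = 4 := fun i => by rw [← dN_univ, h.2.1]
  have hX : ∀ i ∈ X, i ≠ w → ∀ j ∈ Xᶜ, ¬ Γ.Adj i j := by
    intro i hi hiw j hj hij
    have := hw _ (mem_cutE Γ X i j hi hj hij)
    rw [Sym2.mem_iff] at this
    rcases this with rfl | rfl
    · exact hiw rfl
    · simp at hj; exact hj hwX
  have h3 : dN Γ w Xᶜ = 4 := by
    rw [← hcut, cutN_eq, Finset.sum_eq_single w]
    · intro i hi hiw; exact dN_zero Γ i _ (hX i hi hiw)
    · intro hh; exact absurd hwX hh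
  have h4 := dN_union Γ w X Xᶜ disjoint_compl_right
  rw [Finset.union_compl, hreg', h3] at h4
  have h5 : dN Γ w X = 0 := by omega
  rw [dN_zero_iff] at h5
  obtain ⟨i, hi, j, hj, hij⟩ := conn_cut Γ h.1 (X.erase w)
    (by rw [← Finset.card_pos, Finset.card_erase_of_mem hwX]; omega) ⟨w, by simp⟩
  rw [Finset.mem_erase] at hi
  by_cases hjX : j ∈ X
  · have : j = w := by
      by_contra hh
      simp [hh, hjX] at hj
    subst this
    exact h5 i hi.2 hij.symm
  · exact hX i hi.2 hi.1 j (by simpa using hjX) hij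

lemma crit_of_cp {W : Type*} [Fintype W] (Γ : SimpleGraph W) (h : IsCompletedPrimitive Γ) :
    CutCrit Γ := by
  have hreg' : ∀ i, dN Γ i Finset.univ = 4 := fun i => by rw [← dN_univ, h.2.1]
  refine ⟨hreg', h.2.2.1, fun X h1 h2 => ?_⟩
  by_contra hlt
  push Not at hlt
  have hn1 : X.Nonempty := Finset.card_pos.1 (by omega)
  have hn2 : Xᶜ.Nonempty := Finset.card_pos.1 (by omega)
  obtain ⟨i, hi, j, hj, hij⟩ := conn_cut Γ h.1 X hn1 hn2
  have hpos : cutN Γ X Xᶜ ≠ 0 := by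
    intro h0
    rw [cutN_eq, Finset.sum_eq_zero_iff] at h0
    exact (dN_zero_iff Γ i _).1 (h0 i hi) j hj hij
  obtain ⟨k, hk⟩ := cutN_even Γ hreg' X
  have hc := cutE_card Γ X
  by_cases h4 : cutN Γ X Xᶜ = 4
  · obtain ⟨w, hw⟩ := cut_star Γ h X hn1 hn2 (cutE Γ X) (cutE_edge Γ X) (by omega)
      (fun i hi j hj hij => mem_cutE Γ X i j hi hj hij)
    by_cases hwX : w ∈ X
    · exact crit_aux Γ h X h1 hn2 w hwX h4 hw
    · refine crit_aux Γ h Xᶜ h2 (by rwa [compl_compl]) w (by simpa using hwX)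
        (by rw [compl_compl, cutN_comm, h4]) (fun e he => hw e ?_)
      unfold cutE at he
      rw [Finset.mem_image] at he
      obtain ⟨p, hp, rfl⟩ := he
      simp only [compl_compl, Finset.mem_filter, Finset.mem_product] at hp
      rw [Sym2.eq_swap]
      exact mem_cutE Γ X _ _ hp.1.2 hp.1.1 hp.2.symm
  · obtain ⟨f1, hf1, hf1'⟩ := edge_avoid Γ hreg' h.2.2.1 i
    obtain ⟨f2, hf2, hf2'⟩ := edge_avoid Γ hreg' h.2.2.1 j
    obtain ⟨w, hw⟩ := cut_star Γ h X hn1 hn2 (insert f1 (insert f2 (cutE Γ X)))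
      (by
        intro e he
        simp only [Finset.mem_insert] at he
        rcases he with rfl | rfl | he
        · exact hf1
        · exact hf2
        · exact cutE_edge Γ X e he)
      (by
        have h3 := Finset.card_insert_le f1 (insert f2 (cutE Γ X))
        have h4 := Finset.card_insert_le f2 (cutE Γ X)
        omega)
      (fun i hi j hj hij => by simp [mem_cutE Γ X i j hi hj hij])
    have := hw _ (Finset.mem_insert_of_mem (Finset.mem_insert_of_mem (mem_cutE Γ X i j hi hj hij)))
    rw [Sym2.mem_iff] at this
    rcases this with rfl | rfl
    · exact hf1' (hw _ (by simp))
    · exact hf2' (hw _ (by simp))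

lemma delVert_conn {W : Type*} [Fintype W] (Γ : SimpleGraph W) (h : CutCrit Γ) (v : W) :
    (delVert Γ v).Connected := by
  obtain ⟨hreg, h5, hcut⟩ := h
  have : Nontrivial W := Fintype.one_lt_card_iff_nontrivial.1 (by omega)
  obtain ⟨x, hx⟩ := exists_ne v
  have : Nonempty ↥{u : W | u ≠ v} := ⟨⟨x, hx⟩⟩
  by_contra hcon
  obtain ⟨X, h1, h2, h3⟩ := not_conn_cut _ hcon
  set Y : Finset W := X.map (Function.Embedding.subtype _) with hY
  have hvY : v ∉ Y := by simp [hY]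
  have hYv : ∀ i ∈ Y, ∀ j ∈ Yᶜ, Γ.Adj i j → j = v := by
    intro i hi j hj hij
    by_contra hjv
    simp only [hY, Finset.mem_map, Function.Embedding.subtype_apply, Finset.mem_compl] at hi hj
    obtain ⟨i', hi', rfl⟩ := hi
    refine h3 i' hi' ⟨j, hjv⟩ ?_ hij
    simp only [Finset.mem_compl]
    intro hh
    exact hj ⟨_, hh, rfl⟩
  have hc : ∀ i ∈ Y, dN Γ i Yᶜ = if Γ.Adj v i then 1 else 0 := by
    intro i hi
    unfold dN
    rw [Finset.sum_eq_single v, Γ.adj_comm]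
    · intro j hj hjv
      rw [if_neg]
      intro hij
      exact hjv (hYv i hi j hj hij)
    · intro hh; simp at hh; exact absurd hh hvY
  have hc2 : cutN Γ Y Yᶜ ≤ 4 := by
    rw [cutN_eq, Finset.sum_congr rfl hc, ← hreg v]
    exact dN_mono Γ v _ _ (Finset.subset_univ _)
  have hY2 : 2 ≤ Y.card := by
    obtain ⟨i, hi⟩ := h1
    have hi' : i.1 ∈ Y := by simp only [hY, Finset.mem_map]; exact ⟨i, hi, rfl⟩
    have h4 := dN_union Γ i.1 Y Yᶜ disjoint_compl_right
    rw [Finset.union_compl, hreg, hc _ hi'] at h4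
    have := dN_le Γ i.1 Y
    split_ifs at h4 <;> omega
  have hYc : 2 ≤ Yᶜ.card := by
    obtain ⟨j, hj⟩ := h2
    have : ({v, j.1} : Finset W) ⊆ Yᶜ := by
      intro k hk
      simp only [Finset.mem_insert, Finset.mem_singleton] at hk
      rcases hk with rfl | rfl
      · simpa using hvY
      · simp only [hY, Finset.mem_compl, Finset.mem_map]
        rintro ⟨i, hi, hij⟩
        have : i = j := Subtype.ext hij
        subst this
        simp at hj; exact hj hi
    have h6 := Finset.card_le_card this
    rw [Finset.card_pair (Ne.symm j.2)] at h6
    exact h6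
  have := hcut Y hY2 hYc
  omega


lemma FG_map {V W : Type*} [Fintype V] [Fintype W] (G : SimpleGraph V) (φ : V ↪ W) (v : V)
    (x : W → HH) : FG G v (fun i => x (φ i)) = FG (G.map φ) (φ v) x := by
  unfold FG
  refine Fintype.prod_of_injective φ φ.injective _ _ (fun p hp => ?_) (fun i => ?_)
  · refine Finset.prod_eq_one fun q _ => ?_
    rw [if_neg]
    rintro ⟨h, -⟩
    rw [SimpleGraph.map_adj] at h
    obtain ⟨u, w, -, h, -⟩ := h
    exact hp ⟨u, h⟩
  · refine Fintype.prod_of_injective φ φ.injective _ _ (fun p hp => ?_) (fun j => ?_)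
    · rw [if_neg]
      rintro ⟨h, -⟩
      rw [SimpleGraph.map_adj] at h
      obtain ⟨u, w, -, -, h⟩ := h
      exact hp ⟨w, h⟩
    · have hadj : (G.map φ).Adj (φ i) (φ j) ↔ G.Adj i j := by
        rw [SimpleGraph.map_adj]
        constructor
        · rintro ⟨u, w, h, h1, h2⟩
          rw [← φ.injective h1, ← φ.injective h2]; exact h
        · exact fun h => ⟨i, j, h, rfl, rfl⟩
      simp [hadj]

lemma posInt_map {V W : Type*} [Fintype V] [Fintype W] (G : SimpleGraph V) (φ : V ↪ W)
    (a b c : V) (s : Finset W) (hs : ∀ p, p ∈ s ↔ ∃ i, i ≠ a ∧ i ≠ b ∧ i ≠ c ∧ φ i = p) :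
    LM s (FG (G.map φ) (φ a)) (Pi.single (φ c) 1) = posInt G a b c := by
  have h1 := LM_image φ φ.injective (Finset.univ \ {a, b, c}) (FG G a) (FG_measurable G a)
    (Pi.single (φ c) 1)
  simp_rw [FG_map] at h1
  have h2 : (Finset.univ \ {a, b, c} : Finset V).image φ = s := by
    ext p
    simp [hs, and_assoc]
  have h3 : (fun i => (Pi.single (φ c) 1 : W → HH) (φ i)) = Pi.single c 1 := by
    ext1 i
    by_cases h : i = c
    · subst h; simp
    · have : φ i ≠ φ c := fun hh => h (φ.injective hh)
      simp [h, this]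
  rw [h2, h3] at h1
  exact h1

lemma posInt_glue {W V₁ V₂ : Type*} [Fintype W] [Fintype V₁] [Fintype V₂] (Γ : SimpleGraph W)
    (G₁ : SimpleGraph V₁) (G₂ : SimpleGraph V₂) (φ₁ : V₁ ↪ W) (φ₂ : V₂ ↪ W)
    (a₁ b₁ c₁ : V₁) (a₂ b₂ c₂ : V₂) (ha : φ₁ a₁ = φ₂ a₂) (hb : φ₁ b₁ = φ₂ b₂) (hc : φ₁ c₁ = φ₂ c₂)
    (hab : a₁ ≠ b₁) (hac : a₁ ≠ c₁) (hbc : b₁ ≠ c₁)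
    (hcov : ∀ p, (∃ i, φ₁ i = p) ∨ (∃ j, φ₂ j = p))
    (hint : ∀ i j, φ₁ i = φ₂ j → i = a₁ ∨ i = b₁ ∨ i = c₁)
    (hadj : ∀ p q, Γ.Adj p q ↔ ((G₁.map φ₁).Adj p q ∨ (G₂.map φ₂).Adj p q) ∧
      ¬ ((p = φ₁ a₁ ∨ p = φ₁ b₁ ∨ p = φ₁ c₁) ∧ (q = φ₁ a₁ ∨ q = φ₁ b₁ ∨ q = φ₁ c₁))) :
    posInt Γ (φ₁ a₁) (φ₁ b₁) (φ₁ c₁) = posInt G₁ a₁ b₁ c₁ * posInt G₂ a₂ b₂ c₂ := by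
  have hint' : ∀ i j, φ₁ i = φ₂ j → j = a₂ ∨ j = b₂ ∨ j = c₂ := by
    intro i j h
    rcases hint i j h with rfl | rfl | rfl
    · left; exact φ₂.injective (h.symm.trans ha)
    · right; left; exact φ₂.injective (h.symm.trans hb)
    · right; right; exact φ₂.injective (h.symm.trans hc)
  set S₁ : Finset W := (Finset.univ \ {a₁, b₁, c₁}).image φ₁ with hS₁
  set S₂ : Finset W := (Finset.univ \ {a₂, b₂, c₂}).image φ₂ with hS₂
  have hdisj : Disjoint S₁ S₂ := by
    rw [Finset.disjoint_left]
    intro p h1 h2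
    simp only [hS₁, hS₂, Finset.mem_image, Finset.mem_sdiff, Finset.mem_univ, true_and,
      Finset.mem_insert, Finset.mem_singleton] at h1 h2
    obtain ⟨i, hi, rfl⟩ := h1
    obtain ⟨j, hj, h⟩ := h2
    exact hi (hint i j h.symm)
  have hmem₁ : ∀ p, p ∈ S₁ ↔ ∃ i, i ≠ a₁ ∧ i ≠ b₁ ∧ i ≠ c₁ ∧ φ₁ i = p := by
    intro p; simp [hS₁, and_assoc]
  have hmem₂ : ∀ p, p ∈ S₂ ↔ ∃ i, i ≠ a₂ ∧ i ≠ b₂ ∧ i ≠ c₂ ∧ φ₂ i = p := by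
    intro p; simp [hS₂, and_assoc]
  have hun : (Finset.univ \ {φ₁ a₁, φ₁ b₁, φ₁ c₁} : Finset W) = S₁ ∪ S₂ := by
    ext p
    simp only [Finset.mem_sdiff, Finset.mem_univ, true_and, Finset.mem_insert,
      Finset.mem_singleton, Finset.mem_union, not_or]
    constructor
    · rintro ⟨h1, h2, h3⟩
      rcases hcov p with ⟨i, rfl⟩ | ⟨j, rfl⟩
      · left; rw [hmem₁]
        exact ⟨i, fun h => h1 (by rw [h]), fun h => h2 (by rw [h]), fun h => h3 (by rw [h]), rfl⟩
      · right; rw [hmem₂]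
        exact ⟨j, fun h => h1 (by rw [h, ha]), fun h => h2 (by rw [h, hb]),
          fun h => h3 (by rw [h, hc]), rfl⟩
    · rintro (h | h)
      · rw [hmem₁] at h
        obtain ⟨i, h1, h2, h3, rfl⟩ := h
        exact ⟨fun h => h1 (φ₁.injective h), fun h => h2 (φ₁.injective h),
          fun h => h3 (φ₁.injective h)⟩
      · rw [hmem₂] at h
        obtain ⟨i, h1, h2, h3, rfl⟩ := h
        rw [ha, hb, hc]
        exact ⟨fun h => h1 (φ₂.injective h), fun h => h2 (φ₂.injective h),
          fun h => h3 (φ₂.injective h)⟩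
  have hFG : ∀ z : W → HH, z (φ₁ b₁) = 0 → z (φ₁ c₁) = 1 → FG Γ (φ₁ a₁) z =
      FG (G₁.map φ₁) (φ₁ a₁) z * FG (G₂.map φ₂) (φ₂ a₂) z := by
    intro z hzb hzc
    unfold FG
    simp_rw [← Finset.prod_mul_distrib]
    refine Finset.prod_congr rfl fun p _ => Finset.prod_congr rfl fun q _ => ?_
    rw [← ha]
    by_cases hT : ((p = φ₁ a₁ ∨ p = φ₁ b₁ ∨ p = φ₁ c₁) ∧ (q = φ₁ a₁ ∨ q = φ₁ b₁ ∨ q = φ₁ c₁))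
    · rw [if_neg (by rw [hadj]; tauto)]
      by_cases hpa : p = φ₁ a₁
      · simp [hpa]
      by_cases hqa : q = φ₁ a₁
      · simp [hqa]
      by_cases hpq : p = q
      · simp [hpq]
      have h1 : ‖z p - z q‖ₑ = 1 := by
        rcases hT with ⟨h | rfl | rfl, h' | rfl | rfl⟩
        all_goals first | contradiction | simp [hzb, hzc]
      simp [h1]
    · have h12 : ¬ ((G₁.map φ₁).Adj p q ∧ (G₂.map φ₂).Adj p q) := by
        rintro ⟨h1, h2⟩
        rw [SimpleGraph.map_adj] at h1 h2
        obtain ⟨i, j, -, rfl, rfl⟩ := h1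
        obtain ⟨i', j', -, h3, h4⟩ := h2
        refine hT ⟨?_, ?_⟩
        · rcases hint _ _ h3.symm with rfl | rfl | rfl <;> simp
        · rcases hint _ _ h4.symm with rfl | rfl | rfl <;> simp
      rw [hadj]
      by_cases h1 : (G₁.map φ₁).Adj p q <;> by_cases h2 : (G₂.map φ₂).Adj p q
      · exact absurd ⟨h1, h2⟩ h12
      · simp only [h1, h2, hT, true_or, not_false_eq_true, true_and, false_and, if_false, mul_one]
      · simp only [h1, h2, hT, or_true, not_false_eq_true, true_and, false_and, if_false, one_mul]
      · simp only [h1, h2, or_self, false_and, if_false, one_mul]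
  have hm₁ := FG_measurable (G₁.map φ₁) (φ₁ a₁)
  have hm₂ := FG_measurable (G₂.map φ₂) (φ₂ a₂)
  have hdep₁ : ∀ x y : W → HH, (∀ i, i ∉ S₂ → x i = y i) →
      FG (G₁.map φ₁) (φ₁ a₁) x = FG (G₁.map φ₁) (φ₁ a₁) y := by
    intro x y h
    rw [← FG_map, ← FG_map]
    congr 1
    ext1 i
    apply h
    rw [hmem₂]
    rintro ⟨j, h1, h2, h3, h4⟩
    have := hint' i j h4.symm
    tauto
  have hdep₂ : ∀ x y : W → HH, (∀ i, i ∉ S₁ → x i = y i) →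
      FG (G₂.map φ₂) (φ₂ a₂) x = FG (G₂.map φ₂) (φ₂ a₂) y := by
    intro x y h
    rw [← FG_map, ← FG_map]
    congr 1
    ext1 i
    apply h
    rw [hmem₁]
    rintro ⟨j, h1, h2, h3, h4⟩
    have := hint j i h4
    tauto
  rw [← posInt_map G₁ φ₁ a₁ b₁ c₁ S₁ hmem₁, ← posInt_map G₂ φ₂ a₂ b₂ c₂ S₂ hmem₂]
  unfold posInt
  rw [hun, LM_congr _ _ (fun z => FG (G₁.map φ₁) (φ₁ a₁) z * FG (G₂.map φ₂) (φ₂ a₂) z)]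
  · have h1 : LM (S₁ ∪ S₂) (fun z => FG (G₁.map φ₁) (φ₁ a₁) z * FG (G₂.map φ₂) (φ₂ a₂) z)
        (Pi.single (φ₁ c₁) 1) = LM S₁ (LM S₂ (fun z => FG (G₁.map φ₁) (φ₁ a₁) z *
          FG (G₂.map φ₂) (φ₂ a₂) z)) (Pi.single (φ₁ c₁) 1) := by
      exact congrFun (lmarginal_union _ _ (hm₁.mul hm₂) hdisj) _
    rw [h1]
    have h2 : LM S₂ (fun z => FG (G₁.map φ₁) (φ₁ a₁) z * FG (G₂.map φ₂) (φ₂ a₂) z) =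
        fun z => LM S₂ (FG (G₂.map φ₂) (φ₂ a₂)) z * FG (G₁.map φ₁) (φ₁ a₁) z := by
      ext1 z
      rw [LM_mul_left S₂ _ _ hm₂ hdep₁, mul_comm]
    rw [h2, LM_mul_left S₁ _ _ hm₁, mul_comm, hc]
    intro x y h
    refine LM_dep _ _ _ _ fun z z' hz hz' hzz => hdep₂ z z' fun i hi => ?_
    by_cases hi2 : i ∈ S₂
    · exact hzz i hi2
    · rw [hz i hi2, hz' i hi2, h i hi]
  · intro z hz
    have hzb : z (φ₁ b₁) = 0 := by
      rw [hz, Pi.single_eq_of_ne (fun h => hbc (φ₁.injective h))]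
      rw [← hun]; simp
    have hzc : z (φ₁ c₁) = 1 := by
      rw [hz, Pi.single_eq_same]
      rw [← hun]; simp
    exact hFG z hzb hzc


/-- embedding of the second graph into the glued vertex set -/
noncomputable def psi2 {V₁ V₂ : Type*} (a₁ b₁ c₁ : V₁) (a₂ b₂ c₂ : V₂) (j : V₂) :
    V₁ ⊕ {w : V₂ // w ≠ a₂ ∧ w ≠ b₂ ∧ w ≠ c₂} :=
  if ha : j = a₂ then Sum.inl a₁ else if hb : j = b₂ then Sum.inl b₁ else
    if hc : j = c₂ then Sum.inl c₁ else Sum.inr ⟨j, ha, hb, hc⟩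

lemma psi2_inr {V₁ V₂ : Type*} (a₁ b₁ c₁ : V₁) (a₂ b₂ c₂ : V₂) (j : V₂)
    (z : {w : V₂ // w ≠ a₂ ∧ w ≠ b₂ ∧ w ≠ c₂}) :
    psi2 a₁ b₁ c₁ a₂ b₂ c₂ j = Sum.inr z ↔ j = z.1 := by
  obtain ⟨z, h1, h2, h3⟩ := z
  unfold psi2
  split_ifs with ha hb hc
  · subst ha; simp [h1.symm]
  · subst hb; simp [h2.symm]
  · subst hc; simp [h3.symm]
  · simp

lemma psi2_inl {V₁ V₂ : Type*} (a₁ b₁ c₁ : V₁) (a₂ b₂ c₂ : V₂) (hab : a₂ ≠ b₂) (hac : a₂ ≠ c₂)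
    (hbc : b₂ ≠ c₂) (j : V₂) (i : V₁) :
    psi2 a₁ b₁ c₁ a₂ b₂ c₂ j = Sum.inl i ↔
      (j = a₂ ∧ i = a₁) ∨ (j = b₂ ∧ i = b₁) ∨ (j = c₂ ∧ i = c₁) := by
  unfold psi2
  split_ifs with ha hb hc
  · subst ha; simp [hab, hac, eq_comm]
  · subst hb; simp [hab.symm, hbc, eq_comm]
  · subst hc; simp [hac.symm, hbc.symm, eq_comm]
  · simp [ha, hb, hc]

lemma psi2_inj {V₁ V₂ : Type*} (a₁ b₁ c₁ : V₁) (a₂ b₂ c₂ : V₂) (hab : a₂ ≠ b₂) (hac : a₂ ≠ c₂)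
    (hbc : b₂ ≠ c₂) (hab' : a₁ ≠ b₁) (hac' : a₁ ≠ c₁) (hbc' : b₁ ≠ c₁) :
    Function.Injective (psi2 a₁ b₁ c₁ a₂ b₂ c₂) := by
  intro j j' h
  rcases hj : psi2 a₁ b₁ c₁ a₂ b₂ c₂ j' with i | z
  · rw [hj] at h
    rw [psi2_inl _ _ _ _ _ _ hab hac hbc] at h hj
    rcases h with ⟨h1, h2⟩ | ⟨h1, h2⟩ | ⟨h1, h2⟩ <;>
      rcases hj with ⟨h3, h4⟩ | ⟨h3, h4⟩ | ⟨h3, h4⟩ <;> subst h2 <;> simp_all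
  · rw [hj] at h
    rw [psi2_inr] at h hj
    rw [h, hj]

lemma posInt_iso {W W' : Type*} [Fintype W] [Fintype W'] (Γ : SimpleGraph W) (Γ' : SimpleGraph W')
    (e : Γ ≃g Γ') (a b c : W) : posInt Γ' (e a) (e b) (e c) = posInt Γ a b c := by
  have h := posInt_map Γ e.toEquiv.toEmbedding a b c (Finset.univ \ {e a, e b, e c}) (by
    intro p
    simp only [Finset.mem_sdiff, Finset.mem_univ, true_and, Finset.mem_insert,
      Finset.mem_singleton, not_or]
    constructor
    · rintro ⟨h1, h2, h3⟩
      refine ⟨e.symm p, ?_, ?_, ?_, by simp⟩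
      · rintro rfl; simp at h1
      · rintro rfl; simp at h2
      · rintro rfl; simp at h3
    · rintro ⟨i, h1, h2, h3, rfl⟩
      exact ⟨fun h => h1 (e.injective h), fun h => h2 (e.injective h), fun h => h3 (e.injective h)⟩)
  have hΓ : Γ.map e.toEquiv.toEmbedding = Γ' := by
    ext p q
    rw [SimpleGraph.map_adj]
    constructor
    · rintro ⟨u, v, huv, rfl, rfl⟩
      exact e.map_rel_iff.2 huv
    · intro hpq
      exact ⟨e.symm p, e.symm q, e.symm.map_rel_iff.2 hpq, by simp, by simp⟩
  rw [hΓ] at h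
  exact h

lemma glued_adj {V₁ V₂ : Type*} (G₁ : SimpleGraph V₁) (G₂ : SimpleGraph V₂)
    (a₁ b₁ c₁ : V₁) (a₂ b₂ c₂ : V₂) (hab : a₂ ≠ b₂) (hac : a₂ ≠ c₂)
    (hbc : b₂ ≠ c₂) (p q : V₁ ⊕ {w : V₂ // w ≠ a₂ ∧ w ≠ b₂ ∧ w ≠ c₂}) :
    (gluedGraph G₁ G₂ a₁ b₁ c₁ a₂ b₂ c₂).Adj p q ↔
      ((G₁.map Sum.inl).Adj p q ∨ (G₂.map (psi2 a₁ b₁ c₁ a₂ b₂ c₂)).Adj p q) ∧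
      ¬ ((p = Sum.inl a₁ ∨ p = Sum.inl b₁ ∨ p = Sum.inl c₁) ∧
        (q = Sum.inl a₁ ∨ q = Sum.inl b₁ ∨ q = Sum.inl c₁)) := by
  unfold gluedGraph
  rcases p with i | ⟨z, hz1, hz2, hz3⟩ <;> rcases q with j | ⟨z', hz1', hz2', hz3'⟩
  · simp only [SimpleGraph.fromRel_adj, SimpleGraph.map_adj', psi2_inl _ _ _ _ _ _ hab hac hbc,
      Sum.inl.injEq, ne_eq]
    constructor
    · rintro ⟨h, ⟨h1, h2⟩ | ⟨h1, h2⟩⟩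
      · exact ⟨Or.inl ⟨h, i, j, h1, rfl, rfl⟩, h2⟩
      · exact ⟨Or.inl ⟨h, i, j, h1.symm, rfl, rfl⟩, fun h => h2 h.symm⟩
    · rintro ⟨⟨h, u, v, h1, rfl, rfl⟩ | ⟨h, u, v, h1, h2, h3⟩, h4⟩
      · exact ⟨h, Or.inl ⟨h1, h4⟩⟩
      · exfalso; apply h4; tauto
  · simp only [SimpleGraph.fromRel_adj, SimpleGraph.map_adj', psi2_inl _ _ _ _ _ _ hab hac hbc,
      psi2_inr, Sum.inl.injEq, ne_eq, reduceCtorEq, not_false_eq_true, true_and, false_or, or_false,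
      and_false, exists_false, and_true, or_self]
    constructor
    · rintro (⟨rfl, h⟩ | ⟨rfl, h⟩ | ⟨rfl, h⟩)
      · exact ⟨_, _, h, by simp, rfl⟩
      · exact ⟨_, _, h, by simp, rfl⟩
      · exact ⟨_, _, h, by simp, rfl⟩
    · rintro ⟨u, v, h, h1, rfl⟩
      rcases h1 with ⟨rfl, rfl⟩ | ⟨rfl, rfl⟩ | ⟨rfl, rfl⟩
      · left; exact ⟨rfl, h⟩
      · right; left; exact ⟨rfl, h⟩
      · right; right; exact ⟨rfl, h⟩
  · simp only [SimpleGraph.fromRel_adj, SimpleGraph.map_adj', psi2_inl _ _ _ _ _ _ hab hac hbc,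
      psi2_inr, Sum.inl.injEq, ne_eq, reduceCtorEq, not_false_eq_true, true_and, false_or, or_false,
      and_false, exists_false, and_true, or_self, false_and]
    constructor
    · rintro (⟨rfl, h⟩ | ⟨rfl, h⟩ | ⟨rfl, h⟩)
      · exact ⟨_, _, h.symm, rfl, by simp⟩
      · exact ⟨_, _, h.symm, rfl, by simp⟩
      · exact ⟨_, _, h.symm, rfl, by simp⟩
    · rintro ⟨u, v, h, rfl, h1⟩
      rcases h1 with ⟨rfl, rfl⟩ | ⟨rfl, rfl⟩ | ⟨rfl, rfl⟩
      · left; exact ⟨rfl, h.symm⟩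
      · right; left; exact ⟨rfl, h.symm⟩
      · right; right; exact ⟨rfl, h.symm⟩
  · simp only [SimpleGraph.fromRel_adj, SimpleGraph.map_adj', psi2_inr, ne_eq, reduceCtorEq,
      not_false_eq_true, true_and, false_or, and_false, exists_false, and_true, or_self, false_and,
      Sum.inr.injEq, Subtype.mk.injEq]
    constructor
    · rintro ⟨h, h1 | h1⟩
      · exact ⟨h, _, _, h1, rfl, rfl⟩
      · exact ⟨h, _, _, h1.symm, rfl, rfl⟩
    · rintro ⟨h, u, v, h1, rfl, rfl⟩
      exact ⟨h, Or.inl h1⟩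

lemma card_glue {V₁ V₂ : Type*} [Fintype V₁] [Fintype V₂] (a₂ b₂ c₂ : V₂)
    (hab : a₂ ≠ b₂) (hac : a₂ ≠ c₂) (hbc : b₂ ≠ c₂) :
    Fintype.card (V₁ ⊕ {w : V₂ // w ≠ a₂ ∧ w ≠ b₂ ∧ w ≠ c₂}) + 3 =
      Fintype.card V₁ + Fintype.card V₂ := by
  rw [Fintype.card_sum, Fintype.card_subtype]
  have h3 : ({a₂, b₂, c₂} : Finset V₂).card = 3 := by
    rw [Finset.card_insert_of_notMem, Finset.card_insert_of_notMem,
      Finset.card_singleton] <;> simp [*]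
  have : (Finset.univ.filter fun w => w ≠ a₂ ∧ w ≠ b₂ ∧ w ≠ c₂) = ({a₂, b₂, c₂} : Finset V₂)ᶜ := by
    ext w; simp
  rw [this, Finset.card_compl, h3]
  have := Finset.card_le_univ ({a₂, b₂, c₂} : Finset V₂)
  omega

lemma period_posInt {W : Type*} [Fintype W] (Γ : SimpleGraph W) (hΓ : IsCompletedPrimitive Γ)
    (v : W) (e : (delVert Γ v).edgeSet) (a b c : W) (hab : a ≠ b) (hac : a ≠ c) (hbc : b ≠ c) :
    graphPeriod (delVert Γ v) e = (posInt Γ a b c / gC ^ (Fintype.card W - 3)).toReal := by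
  obtain ⟨e, he⟩ := e
  induction e using Sym2.ind with
  | _ u w =>
  have hadj : (delVert Γ v).Adj u w := he
  rw [graphPeriod_posInt Γ hΓ.2.1 v (delVert_conn Γ (crit_of_cp Γ hΓ) v) ⟨s(u, w), he⟩ u w rfl,
    posInt_indep Γ hΓ.2.1 v u w a b c (fun h => u.2 h.symm) (fun h => w.2 h.symm)
      (fun h => hadj.ne (Subtype.ext h)) hab hac hbc]

lemma part2 {W V₁ V₂ : Type*} [Fintype W] [Fintype V₁] [Fintype V₂] (Γ : SimpleGraph W)
    (G₁ : SimpleGraph V₁) (G₂ : SimpleGraph V₂)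
    (hΓ : IsCompletedPrimitive Γ) (h₁ : IsCompletedPrimitive G₁) (h₂ : IsCompletedPrimitive G₂)
    (hg : IsGluing Γ G₁ G₂) (v : W) (e : (delVert Γ v).edgeSet) (v₁ : V₁)
    (e₁ : (delVert G₁ v₁).edgeSet) (v₂ : V₂) (e₂ : (delVert G₂ v₂).edgeSet) :
    graphPeriod (delVert Γ v) e =
      graphPeriod (delVert G₁ v₁) e₁ * graphPeriod (delVert G₂ v₂) e₂ := by
  obtain ⟨a₁, b₁, c₁, a₂, b₂, c₂, ⟨ht1, ht2, ht3⟩, ⟨hs1, hs2, hs3⟩, ⟨f⟩⟩ := hg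
  have hab := hs1.ne
  have hbc := hs2.ne
  have hac := hs3.ne'
  have hab' := ht1.ne
  have hbc' := ht2.ne
  have hac' := ht3.ne'
  set Γ' := gluedGraph G₁ G₂ a₁ b₁ c₁ a₂ b₂ c₂ with hΓ'
  have hpsi : ∀ i, psi2 a₁ b₁ c₁ a₂ b₂ c₂ i = psi2 a₁ b₁ c₁ a₂ b₂ c₂ i := fun _ => rfl
  have key := posInt_glue Γ' G₁ G₂ ⟨Sum.inl, Sum.inl_injective⟩
    ⟨psi2 a₁ b₁ c₁ a₂ b₂ c₂, psi2_inj a₁ b₁ c₁ a₂ b₂ c₂ hab hac hbc hab' hac' hbc'⟩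
    a₁ b₁ c₁ a₂ b₂ c₂
    (by symm; simp [psi2_inl _ _ _ _ _ _ hab hac hbc])
    (by symm; simp [psi2_inl _ _ _ _ _ _ hab hac hbc])
    (by symm; simp [psi2_inl _ _ _ _ _ _ hab hac hbc])
    hab' hac' hbc'
    (by
      rintro (i | z)
      · exact Or.inl ⟨i, rfl⟩
      · exact Or.inr ⟨z.1, by simp [psi2_inr]⟩)
    (by
      intro i j h
      have := ((psi2_inl _ _ _ _ _ _ hab hac hbc) j i).1 h.symm
      tauto)
    (glued_adj G₁ G₂ a₁ b₁ c₁ a₂ b₂ c₂ hab hac hbc)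
  have hiso := posInt_iso Γ Γ' f (f.symm (Sum.inl a₁)) (f.symm (Sum.inl b₁)) (f.symm (Sum.inl c₁))
  simp only [RelIso.apply_symm_apply] at hiso
  simp only [Function.Embedding.coeFn_mk] at key
  rw [period_posInt Γ hΓ v e (f.symm (Sum.inl a₁)) (f.symm (Sum.inl b₁)) (f.symm (Sum.inl c₁))
    (fun h => hab' (Sum.inl_injective (f.symm.injective h)))
    (fun h => hac' (Sum.inl_injective (f.symm.injective h)))
    (fun h => hbc' (Sum.inl_injective (f.symm.injective h))),
    period_posInt G₁ h₁ v₁ e₁ a₁ b₁ c₁ hab' hac' hbc',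
    period_posInt G₂ h₂ v₂ e₂ a₂ b₂ c₂ hab hac hbc, ← ENNReal.toReal_mul, ← hiso, key]
  congr 1
  have hcard : Fintype.card W - 3 = (Fintype.card V₁ - 3) + (Fintype.card V₂ - 3) := by
    have h1 := card_glue (V₁ := V₁) a₂ b₂ c₂ hab hac hbc
    have h2 := Fintype.card_congr f.toEquiv
    have h3 := h₁.2.2.1
    have h4 := h₂.2.2.1
    omega
  rw [hcard, pow_add]
  simp only [div_eq_mul_inv]
  rw [ENNReal.mul_inv (Or.inl (pow_ne_zero _ gC_ne_zero))
    (Or.inl (ENNReal.pow_ne_top gC_ne_top))]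
  ring


lemma half_dN {V W : Type*} (Γ : SimpleGraph W) (T : Finset W) (ι : V → W)
    (hι : Function.Injective ι) (G : SimpleGraph V)
    (hT : ∀ i ∈ T, ∀ j ∈ T, ¬ Γ.Adj i j)
    (hG : ∀ i j, G.Adj i j ↔ Γ.Adj (ι i) (ι j) ∨ (i ≠ j ∧ ι i ∈ T ∧ ι j ∈ T))
    (i : V) (Y : Finset V) :
    dN G i Y = dN Γ (ι i) (Y.image ι) +
      if ι i ∈ T then ((Y.image ι ∩ T).erase (ι i)).card else 0 := by
  have h1 : dN Γ (ι i) (Y.image ι) = ∑ j ∈ Y, if Γ.Adj (ι i) (ι j) then 1 else 0 := by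
    unfold dN
    rw [Finset.sum_image (fun a _ b _ h => hι h)]
  have h2 : ((Y.image ι ∩ T).erase (ι i)).card = ∑ j ∈ Y, if ι j ∈ T ∧ i ≠ j then 1 else 0 := by
    rw [Finset.sum_boole, Nat.cast_id]
    rw [← Finset.card_image_of_injective _ hι]
    congr 1
    ext w
    simp only [Finset.mem_erase, Finset.mem_inter, Finset.mem_image, Finset.mem_filter]
    constructor
    · rintro ⟨h1, ⟨j, hj, rfl⟩, h3⟩
      exact ⟨j, ⟨hj, h3, fun h => h1 (by rw [h])⟩, rfl⟩
    · rintro ⟨j, ⟨hj, h3, h4⟩, rfl⟩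
      exact ⟨fun h => h4 (hι h).symm, ⟨j, hj, rfl⟩, h3⟩
  rw [h1, h2]
  by_cases hi : ι i ∈ T
  · rw [if_pos hi, ← Finset.sum_add_distrib]
    unfold dN
    refine Finset.sum_congr rfl fun j _ => ?_
    rw [if_congr (hG i j) rfl rfl]
    by_cases hj : ι j ∈ T
    · simp [hT _ hi _ hj, hi, hj]
    · simp [hj]
  · rw [if_neg hi, add_zero]
    unfold dN
    refine Finset.sum_congr rfl fun j _ => ?_
    rw [if_congr (hG i j) rfl rfl]
    simp [hi]

lemma half_crit {V W : Type*} [Fintype V] [Fintype W] (Γ : SimpleGraph W) (hΓ : CutCrit Γ)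
    (A B T : Finset W) (hAB : ∀ i ∈ A, i ∉ B) (hAT : ∀ i ∈ A, i ∉ T) (hBT : ∀ i ∈ B, i ∉ T)
    (hun : ∀ i, i ∈ A ∨ i ∈ B ∨ i ∈ T) (hno : ∀ i ∈ A, ∀ j ∈ B, ¬ Γ.Adj i j)
    (hT : ∀ i ∈ T, ∀ j ∈ T, ¬ Γ.Adj i j) (hT3 : T.card = 3) (hA2 : 2 ≤ A.card)
    (hTB : ∀ t ∈ T, dN Γ t B = 2) (ι : V → W)
    (hι : Function.Injective ι) (hr : ∀ w, (∃ v, ι v = w) ↔ w ∉ B) (G : SimpleGraph V)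
    (hG : ∀ i j, G.Adj i j ↔ Γ.Adj (ι i) (ι j) ∨ (i ≠ j ∧ ι i ∈ T ∧ ι j ∈ T)) :
    CutCrit G := by
  obtain ⟨hreg, h5, hcut⟩ := hΓ
  have hB0 : ∀ i, i ∈ A → dN Γ i B = 0 := fun i hi => dN_zero Γ i B (hno i hi)
  have himg : (Finset.univ.image ι) = Bᶜ := by
    ext w; simp [hr]
  have hιB : ∀ i, ι i ∉ B := fun i => (hr _).1 ⟨i, rfl⟩
  have hAorT : ∀ i, ι i ∈ A ∨ ι i ∈ T := fun i => by
    have := hun (ι i); have := hιB i; tauto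
  have hkey := half_dN Γ T ι hι G hT hG
  have hkey2 : ∀ X : Finset V, ((X.image ι) ∩ T).card ≤ 1 → 2 ≤ X.card → 2 ≤ Xᶜ.card →
      5 ≤ cutN G X Xᶜ := by
    intro X hX1 hX2 hX3
    have hc : (X.image ι)ᶜ = Xᶜ.image ι ∪ B := by
      ext w
      simp only [Finset.mem_compl, Finset.mem_image, Finset.mem_union]
      constructor
      · intro h
        by_cases hw : w ∈ B
        · exact Or.inr hw
        · obtain ⟨v, rfl⟩ := (hr w).2 hw
          exact Or.inl ⟨v, fun hv => h ⟨v, hv, rfl⟩, rfl⟩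
      · rintro (⟨v, hv, rfl⟩ | hw) ⟨v', hv', h⟩
        · exact hv (hι h ▸ hv')
        · exact hιB v' (h ▸ hw)
    have hd : Disjoint (Xᶜ.image ι) B := by
      rw [Finset.disjoint_left]
      intro w hw
      obtain ⟨v, -, rfl⟩ := Finset.mem_image.1 hw
      exact hιB v
    have h1 := hcut (X.image ι) (by rwa [Finset.card_image_of_injective _ hι]) (by
      rw [hc, Finset.card_union_of_disjoint hd, Finset.card_image_of_injective _ hι]; omega)
    refine h1.trans ?_
    rw [cutN_eq, cutN_eq, Finset.sum_image (fun a _ b _ h => hι h)]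
    refine Finset.sum_le_sum fun i hi => ?_
    rw [hkey, hc, dN_union _ _ _ _ hd]
    rcases hAorT i with h | h
    · rw [hB0 _ h]; omega
    · rw [hTB _ h, if_pos h]
      have : 2 ≤ ((Xᶜ.image ι ∩ T).erase (ι i)).card := by
        have h2 : T \ (X.image ι ∩ T) ⊆ (Xᶜ.image ι ∩ T).erase (ι i) := by
          intro w hw
          simp only [Finset.mem_sdiff, Finset.mem_inter, not_and] at hw
          have hwX : w ∉ X.image ι := fun hh => hw.2 hh hw.1
          have hwB : w ∉ B := fun hh => hBT w hh hw.1
          have : w ∈ (X.image ι)ᶜ := Finset.mem_compl.2 hwX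
          rw [hc, Finset.mem_union] at this
          simp only [Finset.mem_erase, Finset.mem_inter]
          refine ⟨fun hh => hwX (hh ▸ Finset.mem_image_of_mem ι hi), ?_, hw.1⟩
          tauto
        have h3 := Finset.card_le_card h2
        have h4 := Finset.le_card_sdiff (X.image ι ∩ T) T
        omega
      omega
  refine ⟨fun i => ?_, ?_, fun X h1 h2 => ?_⟩
  · rw [hkey, himg]
    have h1 := dN_union Γ (ι i) B Bᶜ disjoint_compl_right
    rw [Finset.union_compl, hreg] at h1
    rcases hAorT i with h | h
    · rw [hB0 _ h] at h1
      rw [if_neg (hAT _ h)]; omega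
    · rw [hTB _ h] at h1
      rw [if_pos h]
      have h2 : Bᶜ ∩ T = T := by
        ext w; simp only [Finset.mem_inter, Finset.mem_compl]
        exact ⟨fun h => h.2, fun h => ⟨fun hh => hBT w hh h, h⟩⟩
      rw [h2, Finset.card_erase_of_mem h]; omega
  · have h1 : Bᶜ = A ∪ T := by
      ext w; simp only [Finset.mem_compl, Finset.mem_union]
      constructor
      · intro h; have := hun w; tauto
      · rintro (h | h) hh
        · exact hAB w h hh
        · exact hBT w hh h
    rw [← Finset.card_univ, ← Finset.card_image_of_injective _ hι, himg, h1,
      Finset.card_union_of_disjoint (Finset.disjoint_left.2 hAT)]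
    omega
  · by_cases hX : ((X.image ι) ∩ T).card ≤ 1
    · exact hkey2 X hX h1 h2
    · rw [cutN_comm]
      have h3 := hkey2 Xᶜ (by
        have hd : Disjoint (X.image ι ∩ T) (Xᶜ.image ι ∩ T) := by
          rw [Finset.disjoint_left]
          intro w hw hw'
          obtain ⟨v, hv, rfl⟩ := Finset.mem_image.1 (Finset.mem_inter.1 hw).1
          obtain ⟨v', hv', h⟩ := Finset.mem_image.1 (Finset.mem_inter.1 hw').1
          rw [hι h] at hv'
          exact (Finset.mem_compl.1 hv') hv
        have h4 := Finset.card_union_of_disjoint hd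
        have h5 : (X.image ι ∩ T ∪ (Xᶜ.image ι ∩ T)).card ≤ T.card :=
          Finset.card_le_card (Finset.union_subset Finset.inter_subset_right
            Finset.inter_subset_right)
        omega) h2 (by rwa [compl_compl])
      rwa [compl_compl] at h3

lemma split_counts {W : Type*} [Fintype W] (Γ : SimpleGraph W) (hΓ : CutCrit Γ)
    (A B T : Finset W) (hAB : ∀ i ∈ A, i ∉ B) (hAT : ∀ i ∈ A, i ∉ T) (hBT : ∀ i ∈ B, i ∉ T)
    (hun : ∀ i, i ∈ A ∨ i ∈ B ∨ i ∈ T) (hno : ∀ i ∈ A, ∀ j ∈ B, ¬ Γ.Adj i j)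
    (hT3 : T.card = 3) (hA : A.Nonempty) (hB : B.Nonempty) :
    2 ≤ A.card ∧ 2 ≤ B.card ∧ (∀ i ∈ T, ∀ j ∈ T, ¬ Γ.Adj i j) ∧
      (∀ t ∈ T, dN Γ t A = 2) ∧ (∀ t ∈ T, dN Γ t B = 2) := by
  obtain ⟨hreg, h5, hcut⟩ := hΓ
  have dAB : Disjoint A B := Finset.disjoint_left.2 hAB
  have dAT : Disjoint A T := Finset.disjoint_left.2 hAT
  have dBT : Disjoint B T := Finset.disjoint_left.2 hBT
  have dABT : Disjoint (A ∪ B) T := Finset.disjoint_union_left.2 ⟨dAT, dBT⟩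
  have huniv : Finset.univ = (A ∪ B) ∪ T := by
    ext w; have := hun w; simp only [Finset.mem_univ, Finset.mem_union, true_iff]; tauto
  have hsum : ∀ i, dN Γ i A + dN Γ i B + dN Γ i T = 4 := by
    intro i
    rw [← dN_union _ _ _ _ dAB, ← dN_union _ _ _ _ dABT, ← huniv, hreg]
  have hA0 : ∀ i ∈ A, dN Γ i B = 0 := fun i hi => dN_zero Γ i B (hno i hi)
  have hB0 : ∀ i ∈ B, dN Γ i A = 0 := fun i hi => dN_zero Γ i A
    (fun j hj h => hno j hj i hi h.symm)
  have hself : ∀ (S : Finset W), ∀ i ∈ S, dN Γ i S + 1 ≤ S.card := by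
    intro S i hi
    have h1 : dN Γ i S = dN Γ i (S.erase i) := by
      rw [← Finset.insert_erase hi]
      unfold dN
      rw [Finset.sum_insert (Finset.notMem_erase _ _)]
      simp
    have h2 := dN_le Γ i (S.erase i)
    rw [Finset.card_erase_of_mem hi] at h2
    have := Finset.card_pos.2 ⟨i, hi⟩
    omega
  have hA2 : 2 ≤ A.card := by
    obtain ⟨i, hi⟩ := hA
    have h1 := hsum i
    have h2 := hself A i hi
    have h3 := dN_le Γ i T
    rw [hA0 i hi] at h1
    omega
  have hB2 : 2 ≤ B.card := by
    obtain ⟨i, hi⟩ := hB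
    have h1 := hsum i
    have h2 := hself B i hi
    have h3 := dN_le Γ i T
    rw [hB0 i hi] at h1
    omega
  have hAc : Aᶜ = B ∪ T := by
    ext w; simp only [Finset.mem_compl, Finset.mem_union]
    have := hun w; have := hAB w; have := hAT w; tauto
  have hBc : Bᶜ = A ∪ T := by
    ext w; simp only [Finset.mem_compl, Finset.mem_union]
    have := hun w; have := hAB w; have := hBT w; tauto
  have cA : cutN Γ A Aᶜ = cutN Γ A T := by
    rw [cutN_eq, cutN_eq, hAc]
    refine Finset.sum_congr rfl fun i hi => ?_
    rw [dN_union _ _ _ _ dBT, hA0 i hi, zero_add]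
  have cB : cutN Γ B Bᶜ = cutN Γ B T := by
    rw [cutN_eq, cutN_eq, hBc]
    refine Finset.sum_congr rfl fun i hi => ?_
    rw [dN_union _ _ _ _ dAT, hB0 i hi, zero_add]
  have cA5 := hcut A hA2 (by rw [hAc, Finset.card_union_of_disjoint dBT]; omega)
  have cB5 := hcut B hB2 (by rw [hBc, Finset.card_union_of_disjoint dAT]; omega)
  have eA := cutN_even Γ hreg A
  have eB := cutN_even Γ hreg B
  rw [cA] at cA5 eA
  rw [cB] at cB5 eB
  have htot : cutN Γ T A + cutN Γ T B + cutN Γ T T = 12 := by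
    rw [cutN_eq, cutN_eq, cutN_eq, ← Finset.sum_add_distrib, ← Finset.sum_add_distrib,
      Finset.sum_congr rfl (fun i _ => hsum i), Finset.sum_const, hT3]; rfl
  rw [cutN_comm Γ T A, cutN_comm Γ T B] at htot
  obtain ⟨x, hx⟩ := eA
  obtain ⟨y, hy⟩ := eB
  have hA6 : cutN Γ A T = 6 := by omega
  have hB6 : cutN Γ B T = 6 := by omega
  have hT0 : cutN Γ T T = 0 := by omega
  rw [cutN_eq, Finset.sum_eq_zero_iff] at hT0
  have hTT : ∀ i ∈ T, ∀ j ∈ T, ¬ Γ.Adj i j := fun i hi => (dN_zero_iff Γ i T).1 (hT0 i hi)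
  have hbound : ∀ A B : Finset W, Disjoint A B → Disjoint A T → Disjoint B T →
      Aᶜ = B ∪ T → 2 ≤ A.card → 2 ≤ B.card → cutN Γ A T = 6 → (∀ i ∈ A, dN Γ i B = 0) →
      (∀ i, dN Γ i A + dN Γ i B + dN Γ i T = 4) → ∀ t ∈ T, dN Γ t A ≤ 2 := by
    intro A B dAB dAT dBT hAc hA2 hB2 hA6 hA0 hsum t ht
    have htA : t ∉ A := fun h => (Finset.disjoint_left.1 dAT h) ht
    have htB : t ∉ B := fun h => (Finset.disjoint_left.1 dBT h) ht
    have dt : Disjoint A {t} := by simpa using htA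
    have hc : (A ∪ {t})ᶜ = B ∪ T.erase t := by
      rw [Finset.compl_union, hAc]
      ext w
      simp only [Finset.mem_inter, Finset.mem_union, Finset.mem_compl, Finset.mem_singleton,
        Finset.mem_erase]
      have : w ∈ B → w ≠ t := fun h h' => htB (h' ▸ h)
      tauto
    have dB' : Disjoint B (T.erase t) := Finset.disjoint_of_subset_right (Finset.erase_subset _ _) dBT
    have h1 := hcut (A ∪ {t}) (by rw [Finset.card_union_of_disjoint dt]; omega) (by
      rw [hc, Finset.card_union_of_disjoint dB']; omega)
    rw [hc, cutN_union _ _ _ _ dt] at h1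
    have h2 : cutN Γ {t} (B ∪ T.erase t) = dN Γ t B := by
      rw [cutN_eq, Finset.sum_singleton, dN_union _ _ _ _ dB',
        dN_zero Γ t (T.erase t) (fun j hj => hTT t ht j (Finset.mem_of_mem_erase hj)), add_zero]
    have h3 : cutN Γ A (B ∪ T.erase t) + dN Γ t A = 6 := by
      rw [← hA6, cutN_comm, cutN_comm Γ A T, cutN_union _ _ _ _ dB', cutN_comm Γ B A,
        cutN_eq Γ A B, Finset.sum_eq_zero hA0, zero_add, cutN_eq, cutN_eq, add_comm,
        Finset.add_sum_erase _ (fun i => dN Γ i A) ht]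
    have h4 := hsum t
    rw [hT0 t ht] at h4
    omega
  have b1 := hbound A B dAB dAT dBT hAc hA2 hB2 hA6 hA0 hsum
  have b2 := hbound B A dAB.symm dBT dAT hBc hB2 hA2 hB6 hB0
    (fun i => by have := hsum i; omega)
  refine ⟨hA2, hB2, hTT, fun t ht => ?_, fun t ht => ?_⟩
  · have := b1 t ht; have := b2 t ht; have h4 := hsum t; rw [hT0 t ht] at h4; omega
  · have := b1 t ht; have := b2 t ht; have h4 := hsum t; rw [hT0 t ht] at h4; omega


lemma half_exists {W : Type*} [Fintype W] (Γ : SimpleGraph W) (B T : Finset W) :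
    ∃ (n : ℕ) (ι : Fin n → W) (G : SimpleGraph (Fin n)), Function.Injective ι ∧
      (∀ w, (∃ v, ι v = w) ↔ w ∉ B) ∧
      (∀ i j, G.Adj i j ↔ Γ.Adj (ι i) (ι j) ∨ (i ≠ j ∧ ι i ∈ T ∧ ι j ∈ T)) := by
  let e := Fintype.equivFin {w : W // w ∉ B}
  refine ⟨_, fun i => (e.symm i).1, 
    { Adj := fun i j => Γ.Adj (e.symm i).1 (e.symm j).1 ∨
        (i ≠ j ∧ (e.symm i).1 ∈ T ∧ (e.symm j).1 ∈ T)
      symm := ⟨fun i j h => ?_⟩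
      loopless := ⟨fun i h => ?_⟩ }, ?_, ?_, ?_⟩
  · rcases h with h | ⟨h1, h2, h3⟩
    · exact Or.inl h.symm
    · exact Or.inr ⟨h1.symm, h3, h2⟩
  · rcases h with h | ⟨h1, h2, h3⟩
    · exact h.ne rfl
    · exact h1 rfl
  · exact Subtype.val_injective.comp e.symm.injective
  · intro w
    constructor
    · rintro ⟨v, rfl⟩; exact (e.symm v).2
    · intro h; exact ⟨e ⟨w, h⟩, by simp⟩
  · intro i j; rfl

lemma part1_glue {W V₁ V₂ : Type*} (Γ : SimpleGraph W) (A B : Finset W) (a b c : W)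
    (hab : a ≠ b) (hac : a ≠ c) (hbc : b ≠ c)
    (hAB : ∀ i ∈ A, i ∉ B) (hAT : ∀ i ∈ A, i ∉ ({a, b, c} : Finset W))
    (hBT : ∀ i ∈ B, i ∉ ({a, b, c} : Finset W))
    (hun : ∀ i, i ∈ A ∨ i ∈ B ∨ i ∈ ({a, b, c} : Finset W)) (hno : ∀ i ∈ A, ∀ j ∈ B, ¬ Γ.Adj i j)
    (hT : ∀ i ∈ ({a, b, c} : Finset W), ∀ j ∈ ({a, b, c} : Finset W), ¬ Γ.Adj i j)
    (ι₁ : V₁ → W) (G₁ : SimpleGraph V₁) (hι₁ : Function.Injective ι₁)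
    (hr₁ : ∀ w, (∃ v, ι₁ v = w) ↔ w ∉ B)
    (hG₁ : ∀ i j, G₁.Adj i j ↔ Γ.Adj (ι₁ i) (ι₁ j) ∨
      (i ≠ j ∧ ι₁ i ∈ ({a, b, c} : Finset W) ∧ ι₁ j ∈ ({a, b, c} : Finset W)))
    (ι₂ : V₂ → W) (G₂ : SimpleGraph V₂) (hι₂ : Function.Injective ι₂)
    (hr₂ : ∀ w, (∃ v, ι₂ v = w) ↔ w ∉ A)
    (hG₂ : ∀ i j, G₂.Adj i j ↔ Γ.Adj (ι₂ i) (ι₂ j) ∨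
      (i ≠ j ∧ ι₂ i ∈ ({a, b, c} : Finset W) ∧ ι₂ j ∈ ({a, b, c} : Finset W))) :
    IsGluing Γ G₁ G₂ := by
  have mT : ∀ w, w ∈ ({a, b, c} : Finset W) ↔ w = a ∨ w = b ∨ w = c := by intro w; simp
  obtain ⟨a₁, ha₁⟩ := (hr₁ a).2 (fun h => hBT _ h (by simp))
  obtain ⟨b₁, hb₁⟩ := (hr₁ b).2 (fun h => hBT _ h (by simp))
  obtain ⟨c₁, hc₁⟩ := (hr₁ c).2 (fun h => hBT _ h (by simp))
  obtain ⟨a₂, ha₂⟩ := (hr₂ a).2 (fun h => hAT _ h (by simp))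
  obtain ⟨b₂, hb₂⟩ := (hr₂ b).2 (fun h => hAT _ h (by simp))
  obtain ⟨c₂, hc₂⟩ := (hr₂ c).2 (fun h => hAT _ h (by simp))
  have e1 : ∀ u, (u = a₁ ∨ u = b₁ ∨ u = c₁) ↔ ι₁ u ∈ ({a, b, c} : Finset W) := by
    intro u; rw [mT, ← ha₁, ← hb₁, ← hc₁, hι₁.eq_iff, hι₁.eq_iff, hι₁.eq_iff]
  have e2 : ∀ u, (u = a₂ ∨ u = b₂ ∨ u = c₂) ↔ ι₂ u ∈ ({a, b, c} : Finset W) := by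
    intro u; rw [mT, ← ha₂, ← hb₂, ← hc₂, hι₂.eq_iff, hι₂.eq_iff, hι₂.eq_iff]
  have hzT : ∀ z : {w : V₂ // w ≠ a₂ ∧ w ≠ b₂ ∧ w ≠ c₂}, ι₂ z.1 ∉ ({a, b, c} : Finset W) := by
    intro z; rw [← e2]; have := z.2; tauto
  have hzB : ∀ z : {w : V₂ // w ≠ a₂ ∧ w ≠ b₂ ∧ w ≠ c₂}, ι₂ z.1 ∈ B := by
    intro z
    have h1 := hun (ι₂ z.1); have h2 := hzT z; have h3 := (hr₂ (ι₂ z.1)).1 ⟨_, rfl⟩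
    tauto
  refine ⟨a₁, b₁, c₁, a₂, b₂, c₂, ⟨?_, ?_, ?_⟩, ⟨?_, ?_, ?_⟩, ?_⟩
  · exact (hG₁ _ _).2 (Or.inr ⟨fun h => hab (by rw [← ha₁, ← hb₁, h]), by simp [ha₁], by simp [hb₁]⟩)
  · exact (hG₁ _ _).2 (Or.inr ⟨fun h => hbc (by rw [← hb₁, ← hc₁, h]), by simp [hb₁], by simp [hc₁]⟩)
  · exact (hG₁ _ _).2 (Or.inr ⟨fun h => hac (by rw [← ha₁, ← hc₁, h]), by simp [hc₁], by simp [ha₁]⟩)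
  · exact (hG₂ _ _).2 (Or.inr ⟨fun h => hab (by rw [← ha₂, ← hb₂, h]), by simp [ha₂], by simp [hb₂]⟩)
  · exact (hG₂ _ _).2 (Or.inr ⟨fun h => hbc (by rw [← hb₂, ← hc₂, h]), by simp [hb₂], by simp [hc₂]⟩)
  · exact (hG₂ _ _).2 (Or.inr ⟨fun h => hac (by rw [← ha₂, ← hc₂, h]), by simp [hc₂], by simp [ha₂]⟩)
  let f : V₁ ⊕ {w : V₂ // w ≠ a₂ ∧ w ≠ b₂ ∧ w ≠ c₂} → W := Sum.elim ι₁ (fun z => ι₂ z.1)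
  have hf : Function.Bijective f := by
    constructor
    · rintro (u | z) (u' | z') h
      · exact congrArg _ (hι₁ h)
      · exact absurd (hzB z') ((hr₁ _).1 ⟨u, h⟩)
      · exact absurd (hzB z) ((hr₁ _).1 ⟨u', h.symm⟩)
      · exact congrArg _ (Subtype.ext (hι₂ h))
    · intro w
      by_cases hw : w ∈ B
      · obtain ⟨v, rfl⟩ := (hr₂ w).2 (fun h => hAB _ h hw)
        have h1 := hBT _ hw
        rw [← e2] at h1
        push Not at h1
        exact ⟨Sum.inr ⟨v, h1⟩, rfl⟩
      · obtain ⟨v, rfl⟩ := (hr₁ w).2 hw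
        exact ⟨Sum.inl v, rfl⟩
  have k1 : ∀ u v, G₁.Adj u v ∧ ¬((u = a₁ ∨ u = b₁ ∨ u = c₁) ∧ (v = a₁ ∨ v = b₁ ∨ v = c₁)) ↔
      Γ.Adj (ι₁ u) (ι₁ v) := by
    intro u v
    rw [e1, e1, hG₁]
    have := hT (ι₁ u)
    constructor
    · tauto
    · intro h
      refine ⟨Or.inl h, fun hh => hT _ hh.1 _ hh.2 h⟩
  have k2 : ∀ u (z : {w : V₂ // w ≠ a₂ ∧ w ≠ b₂ ∧ w ≠ c₂}),
      ((u = a₁ ∧ G₂.Adj a₂ z.1) ∨ (u = b₁ ∧ G₂.Adj b₂ z.1) ∨ (u = c₁ ∧ G₂.Adj c₂ z.1)) ↔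
      Γ.Adj (ι₁ u) (ι₂ z.1) := by
    intro u z
    have h1 := hzT z
    simp only [hG₂, h1, and_false, or_false, ha₂, hb₂, hc₂]
    constructor
    · rintro (⟨rfl, h⟩ | ⟨rfl, h⟩ | ⟨rfl, h⟩)
      · rwa [ha₁]
      · rwa [hb₁]
      · rwa [hc₁]
    · intro h
      have h2 : ι₁ u ∉ A := fun hh => hno _ hh _ (hzB z) h
      have h3 := (hr₁ (ι₁ u)).1 ⟨u, rfl⟩
      have h4 : ι₁ u ∈ ({a, b, c} : Finset W) := by have := hun (ι₁ u); tauto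
      rw [← e1] at h4
      rcases h4 with rfl | rfl | rfl
      · left; exact ⟨rfl, ha₁ ▸ h⟩
      · right; left; exact ⟨rfl, hb₁ ▸ h⟩
      · right; right; exact ⟨rfl, hc₁ ▸ h⟩
  have k3 : ∀ z z' : {w : V₂ // w ≠ a₂ ∧ w ≠ b₂ ∧ w ≠ c₂}, G₂.Adj z.1 z'.1 ↔
      Γ.Adj (ι₂ z.1) (ι₂ z'.1) := by
    intro z z'
    simp only [hG₂, hzT z, hzT z', and_false, or_false]
  let e : gluedGraph G₁ G₂ a₁ b₁ c₁ a₂ b₂ c₂ ≃g Γ :=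
    { Equiv.ofBijective f hf with
      map_rel_iff' := by
        intro p q
        change Γ.Adj (f p) (f q) ↔ _
        unfold gluedGraph
        rw [SimpleGraph.fromRel_adj]
        rcases p with u | z <;> rcases q with v | z'
        · simp only [f, Sum.elim_inl]
          rw [k1, k1, Γ.adj_comm (ι₁ v), or_self]
          exact ⟨fun h => ⟨fun hh => h.ne (congrArg f hh), h⟩, fun h => h.2⟩
        · simp only [f, Sum.elim_inl, Sum.elim_inr]
          rw [k2]; simp
        · simp only [f, Sum.elim_inl, Sum.elim_inr]
          rw [k2, Γ.adj_comm]; simp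
        · simp only [f, Sum.elim_inr]
          rw [k3, k3, Γ.adj_comm (ι₂ z'.1), or_self]
          exact ⟨fun h => ⟨fun hh => h.ne (congrArg f hh), h⟩, fun h => h.2⟩ }
  exact ⟨e.symm⟩

lemma not_conn_cut' {W : Type*} [Fintype W] [Nonempty W] (Γ : SimpleGraph W)
    (h : ¬ Γ.Connected) :
    ∃ X : Finset W, X.Nonempty ∧ (∃ j, j ∉ X) ∧ ∀ i ∈ X, ∀ j, j ∉ X → ¬ Γ.Adj i j := by
  obtain ⟨X, h1, ⟨j, hj⟩, h3⟩ := not_conn_cut Γ h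
  exact ⟨X, h1, ⟨j, Finset.mem_compl.1 hj⟩, fun i hi j hj => h3 i hi j (Finset.mem_compl.2 hj)⟩

lemma part1 {W : Type*} [Fintype W] (Γ : SimpleGraph W)
    (hΓ : IsCompletedPrimitive Γ) (hred : IsReducible Γ) :
      ∃ (n₁ n₂ : ℕ) (Γ₁ : SimpleGraph (Fin n₁)) (Γ₂ : SimpleGraph (Fin n₂)),
        IsCompletedPrimitive Γ₁ ∧ IsCompletedPrimitive Γ₂ ∧ IsGluing Γ Γ₁ Γ₂ := by
  have hc := crit_of_cp Γ hΓ
  obtain ⟨a, b, c, hab, hac, hbc, hcon⟩ := hred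
  have hT3 : ({a, b, c} : Finset W).card = 3 := Finset.card_eq_three.2 ⟨a, b, c, hab, hac, hbc, rfl⟩
  have mT : ∀ w, w ∈ ({a, b, c} : Finset W) ↔ w = a ∨ w = b ∨ w = c := by intro w; simp
  have : Nonempty ↥{u : W | u ≠ a ∧ u ≠ b ∧ u ≠ c} := by
    obtain ⟨w, hw⟩ : ∃ w, w ∉ ({a, b, c} : Finset W) := by
      by_contra h
      push Not at h
      have h1 := Finset.card_le_card (fun w _ => h w : Finset.univ ⊆ ({a, b, c} : Finset W))
      rw [hT3, Finset.card_univ] at h1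
      have := hc.2.1
      omega
    rw [mT] at hw
    push Not at hw
    exact ⟨⟨w, hw⟩⟩
  obtain ⟨X, hX1, ⟨j₀, hX2⟩, hX3⟩ := not_conn_cut' _ hcon
  let A : Finset W := X.map (Function.Embedding.subtype _)
  let B : Finset W := Finset.univ.filter fun w => ∃ h : w ∈ {u : W | u ≠ a ∧ u ≠ b ∧ u ≠ c}, (⟨w, h⟩ : ↥{u : W | u ≠ a ∧ u ≠ b ∧ u ≠ c}) ∉ X
  have mA : ∀ w, w ∈ A ↔ ∃ h : w ∈ {u : W | u ≠ a ∧ u ≠ b ∧ u ≠ c}, (⟨w, h⟩ : ↥{u : W | u ≠ a ∧ u ≠ b ∧ u ≠ c}) ∈ X := by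
    intro w
    simp only [A, Finset.mem_map]
    constructor
    · rintro ⟨x, hx, rfl⟩; exact ⟨x.2, hx⟩
    · rintro ⟨h, hx⟩; exact ⟨_, hx, rfl⟩
  have mB : ∀ w, w ∈ B ↔ ∃ h : w ∈ {u : W | u ≠ a ∧ u ≠ b ∧ u ≠ c}, (⟨w, h⟩ : ↥{u : W | u ≠ a ∧ u ≠ b ∧ u ≠ c}) ∉ X := by
    intro w
    simp only [B, Finset.mem_filter, Finset.mem_univ, true_and]
  have hAB : ∀ i ∈ A, i ∉ B := by
    intro i hi hi'
    obtain ⟨h, h1⟩ := (mA i).1 hi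
    obtain ⟨h', h2⟩ := (mB i).1 hi'
    exact h2 h1
  have hAT : ∀ i ∈ A, i ∉ ({a, b, c} : Finset W) := by
    intro i hi
    obtain ⟨⟨h1, h2, h3⟩, -⟩ := (mA i).1 hi
    rw [mT]; tauto
  have hBT : ∀ i ∈ B, i ∉ ({a, b, c} : Finset W) := by
    intro i hi
    obtain ⟨⟨h1, h2, h3⟩, -⟩ := (mB i).1 hi
    rw [mT]; tauto
  have hun : ∀ i, i ∈ A ∨ i ∈ B ∨ i ∈ ({a, b, c} : Finset W) := by
    intro i
    by_cases h : i ∈ {u : W | u ≠ a ∧ u ≠ b ∧ u ≠ c}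
    · by_cases h' : (⟨i, h⟩ : ↥{u : W | u ≠ a ∧ u ≠ b ∧ u ≠ c}) ∈ X
      · exact Or.inl ((mA i).2 ⟨h, h'⟩)
      · exact Or.inr (Or.inl ((mB i).2 ⟨h, h'⟩))
    · right; right
      rw [mT]
      simp only [Set.mem_ofPred_eq] at h
      tauto
  have hno : ∀ i ∈ A, ∀ j ∈ B, ¬ Γ.Adj i j := by
    intro i hi j hj hij
    obtain ⟨h, h1⟩ := (mA i).1 hi
    obtain ⟨h', h2⟩ := (mB j).1 hj
    exact hX3 _ h1 _ h2 hij
  obtain ⟨hA2, hB2, hT, hTA, hTB⟩ := split_counts Γ hc A B {a, b, c} hAB hAT hBT hun hno hT3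
    (hX1.map) ⟨j₀.1, (mB _).2 ⟨j₀.2, hX2⟩⟩
  obtain ⟨n₁, ι₁, G₁, hι₁, hr₁, hG₁⟩ := half_exists Γ B {a, b, c}
  obtain ⟨n₂, ι₂, G₂, hι₂, hr₂, hG₂⟩ := half_exists Γ A {a, b, c}
  refine ⟨n₁, n₂, G₁, G₂, cp_of_crit _ ?_, cp_of_crit _ ?_, ?_⟩
  · exact half_crit Γ hc A B {a, b, c} hAB hAT hBT hun hno hT hT3 hA2 hTB ι₁ hι₁ hr₁ G₁ hG₁
  · exact half_crit Γ hc B A {a, b, c} (fun i hi hi' => hAB i hi' hi) hBT hAT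
      (fun i => by have := hun i; tauto) (fun i hi j hj h => hno j hj i hi h.symm)
      hT hT3 hB2 hTA ι₂ hι₂ hr₂ G₂ hG₂
  · exact part1_glue Γ A B a b c hab hac hbc hAB hAT hBT hun hno hT ι₁ G₁ hι₁ hr₁ hG₁
      ι₂ G₂ hι₂ hr₂ hG₂

end helpers

theorem stmt4 {W : Type*} [Fintype W] (Γ : SimpleGraph W)
    (hΓ : IsCompletedPrimitive Γ) :
    (IsReducible Γ →
      ∃ (n₁ n₂ : ℕ) (Γ₁ : SimpleGraph (Fin n₁)) (Γ₂ : SimpleGraph (Fin n₂)),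
        IsCompletedPrimitive Γ₁ ∧ IsCompletedPrimitive Γ₂ ∧ IsGluing Γ Γ₁ Γ₂) ∧
    (∀ (W₁ W₂ : Type) [Fintype W₁] [Fintype W₂]
        (Γ₁ : SimpleGraph W₁) (Γ₂ : SimpleGraph W₂),
      IsCompletedPrimitive Γ₁ → IsCompletedPrimitive Γ₂ → IsGluing Γ Γ₁ Γ₂ →
      ∀ (v : W) (e : (delVert Γ v).edgeSet) (v₁ : W₁) (e₁ : (delVert Γ₁ v₁).edgeSet)
        (v₂ : W₂) (e₂ : (delVert Γ₂ v₂).edgeSet),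
        graphPeriod (delVert Γ v) e =
          graphPeriod (delVert Γ₁ v₁) e₁ * graphPeriod (delVert Γ₂ v₂) e₂) := by
  exact ⟨fun h => part1 Γ hΓ h, fun W₁ W₂ _ _ Γ₁ Γ₂ h₁ h₂ hg v e v₁ e₁ v₂ e₂ =>
    part2 Γ Γ₁ Γ₂ hΓ h₁ h₂ hg v e v₁ e₁ v₂ e₂⟩
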